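/- Let λ be Lebesgue measure on [0,1]² and let 21 ∈ S_2 denote the inversion pattern. There exists θ_c > 0 such that for each θ ∈ (0,θ_c) the supremum sup_{ν∈ℳ}{θ t_{21}(ν) − D(ν|λ)} has a unique maximizer ν_θ ∈ ℳ, and there exists ν* ∈ ℳ̃ with ν* ≠ λ such that, conditioned on the event {t_{21}(π_{n,ν_θ}) ≤ 1/2}, the ν_θ-random permutation π_{n,ν_θ} converges in probability to ν*: for every ε > 0, P({d_LP(Em(π_{n,ν_θ}), ν*) ≥ ε} ∩ {t_{21}(π_{n,ν_θ}) ≤ 1/2}) / P(t_{21}(π_{n,ν_θ}) ≤ 1/2) → 0 as n → ∞. -/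

import Mathlib

open MeasureTheory Filter Topology
open scoped ENNReal

noncomputable section

/-- The plane `ℝ²`, carrier for measures on the unit square. -/
abbrev Ω2 : Type := ℝ × ℝ

/-- The unit square `[0,1]² ⊆ ℝ²`. -/
def unitSq : Set Ω2 := Set.Icc (0 : ℝ) 1 ×ˢ Set.Icc (0 : ℝ) 1

/-- Lebesgue measure on the unit square. -/
def lebSq : Measure Ω2 := volume.restrict unitSq

/-- `𝒫`: Borel probability measures concentrated on the unit square. -/
def Pcal : Set (ProbabilityMeasure Ω2) := {μ | (μ : Measure Ω2) unitSq = 1}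

/-- `ℳ`: members of `𝒫` whose two coordinate marginals are atomless
(equivalently, have continuous CDFs). -/
def Mcal : Set (ProbabilityMeasure Ω2) :=
  {μ | μ ∈ Pcal ∧ (∀ x : ℝ, (μ : Measure Ω2).map Prod.fst {x} = 0) ∧
      ∀ y : ℝ, (μ : Measure Ω2).map Prod.snd {y} = 0}

/-- The uniform distribution on `[0,1]`. -/
def unif01 : Measure ℝ := volume.restrict (Set.Icc (0 : ℝ) 1)

/-- `ℳ̃`: permutons, i.e. members of `𝒫` with both marginals uniform on `[0,1]`. -/
def Mtilde : Set (ProbabilityMeasure Ω2) :=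
  {μ | μ ∈ Pcal ∧ (μ : Measure Ω2).map Prod.fst = unif01 ∧
      (μ : Measure Ω2).map Prod.snd = unif01}

open scoped Classical in
/-- `h_σ`: indicator that the `k` points induce the pattern `σ`. -/
def hPat {k : ℕ} (σ : Equiv.Perm (Fin k)) (z : Fin k → Ω2) : ℝ :=
  if ∃ τ : Equiv.Perm (Fin k),
      StrictMono (fun i => (z (τ i)).1) ∧ StrictMono (fun i => (z (τ (σ⁻¹ i))).2)
  then 1 else 0

/-- Pattern density `t_σ(ν) = ∫ h_σ dν^{⊗k}`. -/
def tPat {k : ℕ} (σ : Equiv.Perm (Fin k)) (ν : Measure Ω2) : ℝ :=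
  ∫ z, hPat σ z ∂(Measure.pi fun _ : Fin k => ν)

open scoped Classical in
/-- The permutation induced by `n` labelled points of `ℝ²` (junk value `1` if the
coordinates are not in generic position). -/
def inducedPerm {n : ℕ} (z : Fin n → Ω2) : Equiv.Perm (Fin n) :=
  if h : ∃ σ : Equiv.Perm (Fin n), hPat σ z = 1 then h.choose else 1

/-- Empirical measure `Em(π) = (1/n) ∑ δ_{(i/n, π(i)/n)}` of a permutation, as a measure. -/
def EmM {n : ℕ} (π : Equiv.Perm (Fin n)) : Measure Ω2 :=
  (n : ℝ≥0∞)⁻¹ • ∑ i : Fin n, Measure.dirac ((((i : ℕ) + 1 : ℝ)) / n, (((π i : ℕ) + 1 : ℝ)) / n)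

open scoped Classical in
/-- Empirical measure of a permutation as a probability measure (junk value for `n = 0`). -/
def EmP {n : ℕ} (π : Equiv.Perm (Fin n)) : ProbabilityMeasure Ω2 :=
  if h : IsProbabilityMeasure (EmM π) then ⟨EmM π, h⟩
  else ⟨Measure.dirac 0, by infer_instance⟩

/-- `t_σ(π) := t_σ(Em(π))`. -/
def tPerm {k n : ℕ} (σ : Equiv.Perm (Fin k)) (π : Equiv.Perm (Fin n)) : ℝ := tPat σ (EmM π)

open scoped Classical in
/-- Kullback–Leibler divergence `D(ν|μ) ∈ [0,∞]`; for probability measures with `ν ≪ μ`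
it equals `∫ log(dν/dμ) dν`, written here through the nonnegative integrand
`g log g + 1 - g` of the density `g = dν/dμ` (the correction `∫ (1-g) dμ = 0`). -/
def KL (ν μ : Measure Ω2) : ℝ≥0∞ :=
  if ν ≪ μ then
    ∫⁻ z, ENNReal.ofReal ((ν.rnDeriv μ z).toReal * Real.log ((ν.rnDeriv μ z).toReal)
      + 1 - (ν.rnDeriv μ z).toReal) ∂μ
  else ∞

/-- CDF of the first marginal. -/
def cdfX (μ : Measure Ω2) (x : ℝ) : ℝ := (μ {p : Ω2 | p.1 ≤ x}).toReal

/-- CDF of the second marginal. -/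
def cdfY (μ : Measure Ω2) (y : ℝ) : ℝ := (μ {p : Ω2 | p.2 ≤ y}).toReal

/-- The map `𝒪`: pushforward of `μ` under `(x,y) ↦ (F₁(x), F₂(y))`. -/
def Omap (μ : Measure Ω2) : Measure Ω2 := μ.map fun p => (cdfX μ p.1, cdfY μ p.2)

/-- The product measure `μ^{⊗n}` governing `n` i.i.d. samples. -/
def pmeas (μ : Measure Ω2) (n : ℕ) : Measure (Fin n → Ω2) := Measure.pi fun _ => μ

/-- Log-partition function `F_n(σ,μ,θ) = log E[exp(nθ t_σ(π_{n,μ}))]`. -/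
def Fn {k : ℕ} (σ : Equiv.Perm (Fin k)) (μ : Measure Ω2) (θ : ℝ) (n : ℕ) : ℝ :=
  Real.log (∫ z, Real.exp (n * θ * tPerm σ (inducedPerm z)) ∂pmeas μ n)

/-- The Gibbs measure `Q_{n,σ,μ,θ}` on `([0,1]²)ⁿ`. -/
def Qgibbs {k : ℕ} (σ : Equiv.Perm (Fin k)) (μ : Measure Ω2) (θ : ℝ) (n : ℕ) :
    Measure (Fin n → Ω2) :=
  (pmeas μ n).withDensity fun z =>
    ENNReal.ofReal (Real.exp (n * θ * tPerm σ (inducedPerm z) - Fn σ μ θ n))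

/-- `F(σ,μ,θ) = sup_{ν ∈ ℳ} { θ t_σ(ν) − D(ν|μ) }`, valued in `EReal`. -/
def Fsup {k : ℕ} (σ : Equiv.Perm (Fin k)) (μ : Measure Ω2) (θ : ℝ) : EReal :=
  ⨆ ν ∈ Mcal, (((θ * tPat σ (ν : Measure Ω2) : ℝ) : EReal) - ((KL (↑ν) μ : ℝ≥0∞) : EReal))

/-- `ℱ(σ,μ,θ)`: the set of maximizers of `ν ↦ θ t_σ(ν) − D(ν|μ)` over `ℳ`. -/
def Fset {k : ℕ} (σ : Equiv.Perm (Fin k)) (μ : Measure Ω2) (θ : ℝ) :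
    Set (ProbabilityMeasure Ω2) :=
  {ν | ν ∈ Mcal ∧
    (((θ * tPat σ (ν : Measure Ω2) : ℝ) : EReal) - ((KL (↑ν) μ : ℝ≥0∞) : EReal)) = Fsup σ μ θ}

/-- `G(σ,μ,δ) = inf { D(ν|μ) : ν ∈ ℳ, t_σ(ν) ≥ δ }`. -/
def Gfun {k : ℕ} (σ : Equiv.Perm (Fin k)) (μ : Measure Ω2) (δ : ℝ) : ℝ≥0∞ :=
  ⨅ ν ∈ {ν : ProbabilityMeasure Ω2 | ν ∈ Mcal ∧ δ ≤ tPat σ (ν : Measure Ω2)}, KL (↑ν) μ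

/-- `𝒢(σ,μ,δ)`: the set of minimizers in the definition of `G(σ,μ,δ)`. -/
def Gset {k : ℕ} (σ : Equiv.Perm (Fin k)) (μ : Measure Ω2) (δ : ℝ) :
    Set (ProbabilityMeasure Ω2) :=
  {ν | (ν ∈ Mcal ∧ δ ≤ tPat σ (ν : Measure Ω2)) ∧ KL (↑ν) μ = Gfun σ μ δ}

/-- `α_σ(μ) = inf {δ : G(σ,μ,δ) = ∞}`. -/
def alphaSig {k : ℕ} (σ : Equiv.Perm (Fin k)) (μ : Measure Ω2) : ℝ :=
  sInf {δ : ℝ | Gfun σ μ δ = ∞}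

/-- `μ` is conditionally constant (CC) with respect to a pattern `σ` of size `k+1`:
the conditional probability `P(π_{X,Y} = σ | (X₁,Y₁))`, which for i.i.d. samples equals
`z ↦ ∫ h_σ(z, w) dμ^{⊗k}(w)`, is `μ`-a.s. equal to a constant `c ∈ [0,1]`. -/
def IsCC {k : ℕ} (σ : Equiv.Perm (Fin (k + 1))) (μ : Measure Ω2) : Prop :=
  ∃ c ∈ Set.Icc (0 : ℝ) 1, ∀ᵐ z ∂μ,
    (∫ w : Fin k → Ω2, hPat σ (Fin.cons z w) ∂pmeas μ k) = c

/-- The inversion pattern `21 ∈ S₂`. -/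
def inv2 : Equiv.Perm (Fin 2) := Equiv.swap 0 1

/-- Lévy–Prokhorov (extended) distance between measures on `ℝ²`. -/
def dLPE (μ ν : Measure Ω2) : ℝ≥0∞ := levyProkhorovEDist μ ν

/-- The topological support of a measure: the points whose every open neighbourhood
has positive measure. -/
def msupport (μ : Measure Ω2) : Set Ω2 :=
  {z | ∀ U : Set Ω2, IsOpen U → z ∈ U → 0 < μ U}

/-- The inversion kernel: `1` if the two points form an inversion, `0` otherwise. -/
def invKer (z w : Ω2) : ℝ := if (z.1 - w.1) * (z.2 - w.2) < 0 then 1 else 0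

/-- The inversion potential of a measure: the mass of the points inverted with `z`. -/
def invPot (ν : Measure Ω2) (z : Ω2) : ℝ := ∫ w, invKer z w ∂ν

lemma invKer_nonneg (z w : Ω2) : 0 ≤ invKer z w := by
  unfold invKer; split_ifs <;> norm_num

lemma invKer_le_one (z w : Ω2) : invKer z w ≤ 1 := by
  unfold invKer; split_ifs <;> norm_num

lemma invKer_comm (z w : Ω2) : invKer z w = invKer w z := by
  have h : (z.1 - w.1) * (z.2 - w.2) = (w.1 - z.1) * (w.2 - z.2) := by ring
  simp only [invKer, h]

lemma invKer_self (z : Ω2) : invKer z z = 0 := by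
  simp [invKer]

lemma measurable_invKer : Measurable (fun p : Ω2 × Ω2 => invKer p.1 p.2) := by
  refine Measurable.ite ?_ measurable_const measurable_const
  exact measurableSet_lt (by fun_prop) (by fun_prop)

lemma measurable_invKer_right (z : Ω2) : Measurable (invKer z) :=
  measurable_invKer.comp measurable_prodMk_left

lemma integrable_invKer_right (ν : Measure Ω2) [IsFiniteMeasure ν] (z : Ω2) :
    Integrable (invKer z) ν :=
  Integrable.of_bound (measurable_invKer_right z).aestronglyMeasurable 1
    (ae_of_all _ fun w => by
      rw [Real.norm_of_nonneg (invKer_nonneg z w)]; exact invKer_le_one z w)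

lemma integrable_invKer (ν : Measure (Ω2 × Ω2)) [IsFiniteMeasure ν] :
    Integrable (fun p : Ω2 × Ω2 => invKer p.1 p.2) ν :=
  Integrable.of_bound measurable_invKer.aestronglyMeasurable 1
    (ae_of_all _ fun p => by
      rw [Real.norm_of_nonneg (invKer_nonneg _ _)]; exact invKer_le_one _ _)

lemma invPot_nonneg (ν : Measure Ω2) (z : Ω2) : 0 ≤ invPot ν z :=
  integral_nonneg fun w => invKer_nonneg z w

lemma invPot_le_one (ν : Measure Ω2) [IsProbabilityMeasure ν] (z : Ω2) : invPot ν z ≤ 1 := by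
  have h := integral_mono (integrable_invKer_right ν z) (integrable_const (1 : ℝ))
    (fun w => invKer_le_one z w)
  simpa [invPot] using h

lemma measurable_invPot (ν : Measure Ω2) [SFinite ν] : Measurable (invPot ν) :=
  (measurable_invKer.stronglyMeasurable.integral_prod_right (ν := ν)).measurable

lemma integrable_invPot (ν μ : Measure Ω2) [IsProbabilityMeasure ν] [IsFiniteMeasure μ] :
    Integrable (invPot ν) μ :=
  Integrable.of_bound (measurable_invPot ν).aestronglyMeasurable 1
    (ae_of_all _ fun w => by
      rw [Real.norm_of_nonneg (invPot_nonneg ν w)]; exact invPot_le_one ν w)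

lemma integral_invPot_comm (μ ν : Measure Ω2) [IsFiniteMeasure μ] [IsFiniteMeasure ν] :
    ∫ z, invPot μ z ∂ν = ∫ z, invPot ν z ∂μ := by
  unfold invPot
  rw [integral_integral_swap (integrable_invKer (ν.prod μ))]
  simp only [invKer_comm]

lemma hPat_inv2 (z : Fin 2 → Ω2) : hPat inv2 z = invKer (z 0) (z 1) := by
  unfold hPat invKer
  congr 1
  simp only [eq_iff_iff, inv2, Equiv.swap_inv]
  constructor
  · rintro ⟨τ, h1, h2⟩
    have a1 := h1 (show (0 : Fin 2) < 1 by decide)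
    have a2 := h2 (show (0 : Fin 2) < 1 by decide)
    simp only [Equiv.swap_apply_left, Equiv.swap_apply_right] at a1 a2
    rcases (by decide : ∀ τ : Equiv.Perm (Fin 2), (τ 0 = 0 ∧ τ 1 = 1) ∨ (τ 0 = 1 ∧ τ 1 = 0)) τ
      with h | h
    · rw [h.1, h.2] at a1 a2; nlinarith
    · rw [h.1, h.2] at a1 a2; nlinarith
  · intro h
    rcases mul_neg_iff.1 h with h | h
    · refine ⟨Equiv.swap 0 1, ?_, ?_⟩
      · refine Fin.strictMono_iff_lt_succ.2 fun i => ?_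
        obtain rfl : i = 0 := Subsingleton.elim _ _
        simpa using h.1
      · refine Fin.strictMono_iff_lt_succ.2 fun i => ?_
        obtain rfl : i = 0 := Subsingleton.elim _ _
        simpa using h.2
    · refine ⟨1, ?_, ?_⟩
      · refine Fin.strictMono_iff_lt_succ.2 fun i => ?_
        obtain rfl : i = 0 := Subsingleton.elim _ _
        simpa using h.1
      · refine Fin.strictMono_iff_lt_succ.2 fun i => ?_
        obtain rfl : i = 0 := Subsingleton.elim _ _
        simpa using h.2

lemma tPat_inv2 (ν : Measure Ω2) [IsFiniteMeasure ν] :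
    tPat inv2 ν = ∫ z, invPot ν z ∂ν := by
  have e := measurePreserving_finTwoArrow ν
  unfold tPat invPot
  rw [← integral_prod (f := fun p : Ω2 × Ω2 => invKer p.1 p.2) (integrable_invKer (ν.prod ν)),
    ← e.integral_comp (MeasurableEquiv.measurableEmbedding _)]
  simp only [hPat_inv2]
  rfl

lemma continuous_invPot (ν : Measure Ω2) [IsFiniteMeasure ν]
    (hx : ∀ x : ℝ, ν {p | p.1 = x} = 0) (hy : ∀ y : ℝ, ν {p | p.2 = y} = 0) :
    Continuous (invPot ν) := by
  rw [continuous_iff_continuousAt]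
  intro z
  refine continuousAt_of_dominated (bound := fun _ => (1 : ℝ))
    (Eventually.of_forall fun z' => (measurable_invKer_right z').aestronglyMeasurable)
    (Eventually.of_forall fun z' => ae_of_all _ fun w => ?_) (integrable_const _) ?_
  · rw [Real.norm_of_nonneg (invKer_nonneg _ w)]; exact invKer_le_one _ w
  · have h1 : ∀ᵐ w ∂ν, w.1 ≠ z.1 := by rw [ae_iff]; simpa using hx z.1
    have h2 : ∀ᵐ w ∂ν, w.2 ≠ z.2 := by rw [ae_iff]; simpa using hy z.2
    filter_upwards [h1, h2] with w h1 h2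
    have hc : ContinuousAt (fun z' : Ω2 => (z'.1 - w.1) * (z'.2 - w.2)) z := by fun_prop
    have hne : (z.1 - w.1) * (z.2 - w.2) ≠ 0 :=
      mul_ne_zero (sub_ne_zero.2 h1.symm) (sub_ne_zero.2 h2.symm)
    rcases lt_or_gt_of_ne hne with h | h
    · have : (fun z' => invKer z' w) =ᶠ[𝓝 z] fun _ => 1 := by
        filter_upwards [hc.eventually_lt_const h] with z' hz'
        simp [invKer, hz']
      exact continuousAt_const.congr this.symm
    · have : (fun z' => invKer z' w) =ᶠ[𝓝 z] fun _ => 0 := by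
        filter_upwards [hc.eventually_const_lt h] with z' hz'
        simp only [invKer, if_neg (not_lt.2 hz'.le)]
      exact continuousAt_const.congr this.symm

/-- The difference of the potentials bounds the quadratic form of `ν - μ`. -/
lemma invPot_sub_quadratic (μ ν : Measure Ω2) [IsProbabilityMeasure μ] [IsProbabilityMeasure ν] :
    tPat inv2 ν - 2 * ∫ z, invPot μ z ∂ν + tPat inv2 μ
      = ∫ z, (invPot ν z - invPot μ z) ∂ν - ∫ z, (invPot ν z - invPot μ z) ∂μ := by
  rw [integral_sub (integrable_invPot _ _) (integrable_invPot _ _),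
    integral_sub (integrable_invPot _ _) (integrable_invPot _ _), integral_invPot_comm ν μ,
    tPat_inv2, tPat_inv2]
  ring

instance isProbabilityMeasure_lebSq : IsProbabilityMeasure lebSq := by
  constructor
  rw [lebSq, Measure.restrict_apply_univ, unitSq, Measure.volume_eq_prod, Measure.prod_prod]
  simp

lemma integrable_exp_of_abs_le {α : Type*} [MeasurableSpace α] {μ : Measure α} [IsFiniteMeasure μ]
    {f : α → ℝ} (hf : Measurable f) {C : ℝ} (hC : ∀ z, |f z| ≤ C) :
    Integrable (fun z => Real.exp (f z)) μ :=
  Integrable.of_bound (by fun_prop) (Real.exp C)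
    (ae_of_all _ fun z => by
      rw [Real.norm_of_nonneg (Real.exp_pos _).le]
      exact Real.exp_le_exp.2 ((le_abs_self _).trans (hC z)))

lemma exp_sub_one_le {r : ℝ} (hr : 0 ≤ r) : min 1 (Real.exp (2 * r) - 1) ≤ 4 * r := by
  rcases le_total (2 * r) 1 with h | h
  · refine (min_le_right _ _).trans ?_
    have := Real.abs_exp_sub_one_le (x := 2 * r) (by rwa [abs_of_nonneg (by linarith)])
    rw [abs_of_nonneg (a := 2 * r) (by linarith)] at this
    linarith [le_abs_self (Real.exp (2 * r) - 1)]
  · exact (min_le_left _ _).trans (by linarith)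

lemma abs_integral_tilted_sub_le {α : Type*} [MeasurableSpace α] (μ : Measure α)
    [IsProbabilityMeasure μ] {f h : α → ℝ} (hf : Measurable f) {r : ℝ} (hr : ∀ z, |f z| ≤ r)
    (hh : Measurable h) (h0 : ∀ z, 0 ≤ h z) (h1 : ∀ z, h z ≤ 1) :
    |∫ z, h z ∂(μ.tilted f) - ∫ z, h z ∂μ| ≤ 4 * r := by
  obtain ⟨z₀⟩ : Nonempty α := (inferInstance : NeZero μ).out |> fun h => by
    by_contra hne
    rw [not_nonempty_iff] at hne
    exact h (Measure.eq_zero_of_isEmpty μ)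
  have hr0 : 0 ≤ r := (abs_nonneg _).trans (hr z₀)
  have hexpf := integrable_exp_of_abs_le (μ := μ) hf hr
  have hP : IsProbabilityMeasure (μ.tilted f) := isProbabilityMeasure_tilted hexpf
  have hb : ∀ z, ‖h z‖ ≤ 1 := fun z => by rw [Real.norm_of_nonneg (h0 z)]; exact h1 z
  have ih : ∀ ν : Measure α, [IsProbabilityMeasure ν] → Integrable h ν := fun ν _ =>
    Integrable.of_bound hh.aestronglyMeasurable 1 (ae_of_all _ hb)
  have bd : ∀ ν : Measure α, [IsProbabilityMeasure ν] → 0 ≤ ∫ z, h z ∂ν ∧ ∫ z, h z ∂ν ≤ 1 := by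
    intro ν _
    refine ⟨integral_nonneg h0, ?_⟩
    simpa using integral_mono (ih ν) (integrable_const (1 : ℝ)) h1
  obtain ⟨a0, a1⟩ := bd μ
  obtain ⟨b0, b1⟩ := bd (μ.tilted f)
  have hZl : Real.exp (-r) ≤ ∫ x, Real.exp (f x) ∂μ := by
    simpa using integral_mono (integrable_const (μ := μ) (Real.exp (-r))) hexpf
      (fun z => Real.exp_le_exp.2 (abs_le.1 (hr z)).1)
  have hZu : ∫ x, Real.exp (f x) ∂μ ≤ Real.exp r := by
    simpa using integral_mono hexpf (integrable_const (μ := μ) (Real.exp r))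
      (fun z => Real.exp_le_exp.2 (abs_le.1 (hr z)).2)
  have hZ0 : 0 < ∫ x, Real.exp (f x) ∂μ := (Real.exp_pos _).trans_le hZl
  have key : ∀ z, Real.exp (-(2 * r)) ≤ Real.exp (f z) / ∫ x, Real.exp (f x) ∂μ ∧
      Real.exp (f z) / ∫ x, Real.exp (f x) ∂μ ≤ Real.exp (2 * r) := by
    intro z
    constructor
    · rw [le_div_iff₀ hZ0]
      calc _ ≤ Real.exp (-(2 * r)) * Real.exp r := by gcongr
        _ = Real.exp (-r) := by rw [← Real.exp_add]; ring_nf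
        _ ≤ _ := Real.exp_le_exp.2 (abs_le.1 (hr z)).1
    · rw [div_le_iff₀ hZ0]
      calc _ ≤ Real.exp r := Real.exp_le_exp.2 (abs_le.1 (hr z)).2
        _ = Real.exp (2 * r) * Real.exp (-r) := by rw [← Real.exp_add]; ring_nf
        _ ≤ _ := by gcongr
  have hi : Integrable (fun z => (Real.exp (f z) / ∫ x, Real.exp (f x) ∂μ) * h z) μ :=
    (hexpf.div_const _).mul_bdd (c := 1) hh.aestronglyMeasurable (ae_of_all _ hb)
  have hl : Real.exp (-(2 * r)) * ∫ z, h z ∂μ ≤ ∫ z, h z ∂(μ.tilted f) := by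
    rw [integral_tilted, ← integral_const_mul]
    exact integral_mono ((ih μ).const_mul _) hi
      (fun z => mul_le_mul_of_nonneg_right (key z).1 (h0 z))
  have hu : ∫ z, h z ∂(μ.tilted f) ≤ Real.exp (2 * r) * ∫ z, h z ∂μ := by
    rw [integral_tilted, ← integral_const_mul]
    exact integral_mono hi ((ih μ).const_mul _)
      (fun z => mul_le_mul_of_nonneg_right (key z).2 (h0 z))
  have hE : Real.exp (-(2 * r)) = (Real.exp (2 * r))⁻¹ := Real.exp_neg _
  have hE1 : 1 ≤ Real.exp (2 * r) := Real.one_le_exp (by linarith)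
  have hE2 : 1 - Real.exp (-(2 * r)) ≤ Real.exp (2 * r) - 1 := by
    rw [hE]
    have := mul_inv_cancel₀ (Real.exp_pos (2 * r)).ne'
    nlinarith [inv_pos.2 (Real.exp_pos (2 * r))]
  refine le_trans (le_min ?_ ?_) (exp_sub_one_le hr0)
  · rw [abs_le]; constructor <;> linarith
  · rw [abs_le]; constructor <;> nlinarith

lemma abs_integral_tilted_sub_tilted_le {α : Type*} [MeasurableSpace α] (μ : Measure α)
    [IsProbabilityMeasure μ] {F G h : α → ℝ} (hF : Measurable F) (hG : Measurable G)
    {C : ℝ} (hC : ∀ z, |G z| ≤ C) {r : ℝ} (hr : ∀ z, |F z - G z| ≤ r)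
    (hh : Measurable h) (h0 : ∀ z, 0 ≤ h z) (h1 : ∀ z, h z ≤ 1) :
    |∫ z, h z ∂(μ.tilted F) - ∫ z, h z ∂(μ.tilted G)| ≤ 4 * r := by
  have hexpf := integrable_exp_of_abs_le (μ := μ) hG hC
  have hP : IsProbabilityMeasure (μ.tilted G) := isProbabilityMeasure_tilted hexpf
  have e : μ.tilted F = (μ.tilted G).tilted (F - G) := by
    rw [tilted_tilted hexpf, add_sub_cancel]
  rw [e]
  exact abs_integral_tilted_sub_le _ (hF.sub hG) hr hh h0 h1

lemma lebSq_fst_eq (x : ℝ) : lebSq {p | p.1 = x} = 0 := by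
  have h : {p : Ω2 | p.1 = x} = {x} ×ˢ Set.univ := by ext p; simp
  refine le_antisymm ((Measure.restrict_apply_le _ _).trans ?_) zero_le
  rw [h, Measure.volume_eq_prod, Measure.prod_prod]; simp

lemma lebSq_snd_eq (y : ℝ) : lebSq {p | p.2 = y} = 0 := by
  have h : {p : Ω2 | p.2 = y} = Set.univ ×ˢ {y} := by ext p; simp
  refine le_antisymm ((Measure.restrict_apply_le _ _).trans ?_) zero_le
  rw [h, Measure.volume_eq_prod, Measure.prod_prod]; simp

lemma continuous_invPot_of_ac {ν : Measure Ω2} [IsFiniteMeasure ν] (h : ν ≪ lebSq) :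
    Continuous (invPot ν) :=
  continuous_invPot ν (fun x => h (lebSq_fst_eq x)) (fun y => h (lebSq_snd_eq y))

/-- The self-consistency equation `ν ∝ exp(g + s · V_ν) λ` for tilts of Lebesgue measure by an
external field `g` and their own inversion potential. -/
def IsSelfTilt (g : Ω2 → ℝ) (s : ℝ) (ν : Measure Ω2) : Prop :=
  ν = lebSq.tilted (fun z => g z + s * invPot ν z)

lemma abs_field_le {g φ : Ω2 → ℝ} {C s : ℝ} (hC : ∀ z, |g z| ≤ C) (h0 : ∀ z, 0 ≤ φ z)
    (h1 : ∀ z, φ z ≤ 1) (z : Ω2) : |g z + s * φ z| ≤ C + |s| := by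
  refine (abs_add_le _ _).trans (add_le_add (hC z) ?_)
  rw [abs_mul, abs_of_nonneg (h0 z)]
  exact mul_le_of_le_one_right (abs_nonneg s) (h1 z)

lemma exists_isSelfTilt {g : Ω2 → ℝ} (hg : Measurable g) {C : ℝ} (hC : ∀ z, |g z| ≤ C)
    {s : ℝ} (hs : |s| ≤ 1 / 8) :
    ∃ ν : Measure Ω2, IsProbabilityMeasure ν ∧ IsSelfTilt g s ν := by
  have hm : ∀ φ : BoundedContinuousFunction Ω2 ℝ, Measurable (fun z => g z + s * φ z) :=
    fun φ => hg.add (φ.continuous.measurable.const_mul s)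
  have hb : ∀ φ : BoundedContinuousFunction Ω2 ℝ, ∀ z,
      |g z + s * φ z| ≤ C + |s| * ‖φ‖ := fun φ z => by
    refine (abs_add_le _ _).trans (add_le_add (hC z) ?_)
    rw [abs_mul]
    exact mul_le_mul_of_nonneg_left (φ.norm_coe_le_norm z) (abs_nonneg s)
  have hP : ∀ φ : BoundedContinuousFunction Ω2 ℝ,
      IsProbabilityMeasure (lebSq.tilted (fun z => g z + s * φ z)) := fun φ =>
    isProbabilityMeasure_tilted (integrable_exp_of_abs_le (hm φ) (hb φ))
  let T : BoundedContinuousFunction Ω2 ℝ → BoundedContinuousFunction Ω2 ℝ := fun φ =>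
    BoundedContinuousFunction.ofNormedAddCommGroup
      (invPot (lebSq.tilted (fun z => g z + s * φ z)))
      (continuous_invPot_of_ac (tilted_absolutelyContinuous _ _)) 1
      (fun z => by
        rw [Real.norm_of_nonneg (invPot_nonneg _ z)]; exact invPot_le_one _ z)
  have hT : ContractingWith (1 / 2) T := by
    refine ⟨by norm_num, LipschitzWith.of_dist_le_mul fun φ ψ => ?_⟩
    rw [BoundedContinuousFunction.dist_le (by positivity)]
    intro z
    have h := abs_integral_tilted_sub_tilted_le lebSq (hm φ) (hm ψ) (hb ψ)
      (r := |s| * dist φ ψ) (h := invKer z) (fun w => ?_) (measurable_invKer_right z)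
      (invKer_nonneg z) (invKer_le_one z)
    · refine h.trans ?_
      have : (0 : ℝ) ≤ dist φ ψ := dist_nonneg
      have : (((1 / 2 : NNReal)) : ℝ) = 1 / 2 := by norm_num
      rw [this]
      nlinarith
    · have e : g w + s * φ w - (g w + s * ψ w) = s * (φ w - ψ w) := by ring
      rw [e, abs_mul]
      exact mul_le_mul_of_nonneg_left
        (BoundedContinuousFunction.dist_coe_le_dist (f := φ) (g := ψ) w) (abs_nonneg s)
  set φ := hT.fixedPoint T with hφ
  have hfix : T φ = φ := hT.fixedPoint_isFixedPt
  refine ⟨lebSq.tilted (fun z => g z + s * φ z), hP φ, ?_⟩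
  have : ∀ z, invPot (lebSq.tilted (fun z => g z + s * φ z)) z = φ z := fun z =>
    congrArg (fun f : BoundedContinuousFunction Ω2 ℝ => f z) hfix
  unfold IsSelfTilt
  simp only [this]

/-- Lipschitz dependence of self-consistent tilts on the field and the coupling. -/
lemma IsSelfTilt.abs_tPat_sub_le {g g' : Ω2 → ℝ} {s s' : ℝ} {ν ν' : Measure Ω2}
    [IsProbabilityMeasure ν] [IsProbabilityMeasure ν']
    (h : IsSelfTilt g s ν) (h' : IsSelfTilt g' s' ν') (hg : Measurable g) (hg' : Measurable g')
    {C d : ℝ} (hC : ∀ z, |g' z| ≤ C) (hd : ∀ z, |g z - g' z| ≤ d) (hs : |s| ≤ 1 / 8) :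
    |tPat inv2 ν - tPat inv2 ν'| ≤ 20 * (d + |s - s'|) := by
  have hd0 : 0 ≤ d := (abs_nonneg _).trans (hd 0)
  have hm := hg.add ((measurable_invPot ν).const_mul s)
  have hm' := hg'.add ((measurable_invPot ν').const_mul s')
  have hb' := abs_field_le (s := s') hC (invPot_nonneg ν') (invPot_le_one ν')
  have step : ∀ D : ℝ, (∀ z, |invPot ν z - invPot ν' z| ≤ D) →
      ∀ z, |(g z + s * invPot ν z) - (g' z + s' * invPot ν' z)| ≤ d + |s - s'| + D / 8 := by
    intro D hD z
    have e : (g z + s * invPot ν z) - (g' z + s' * invPot ν' z)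
        = (g z - g' z) + (s - s') * invPot ν' z + s * (invPot ν z - invPot ν' z) := by ring
    rw [e]
    refine (abs_add_le _ _).trans (add_le_add ((abs_add_le _ _).trans
      (add_le_add (hd z) ?_)) ?_)
    · rw [abs_mul, abs_of_nonneg (invPot_nonneg _ _)]
      exact mul_le_of_le_one_right (abs_nonneg _) (invPot_le_one _ _)
    · rw [abs_mul]
      have := mul_le_mul hs (hD z) (abs_nonneg _) (by norm_num)
      linarith
  have cmp : ∀ r : ℝ, (∀ z, |(g z + s * invPot ν z) - (g' z + s' * invPot ν' z)| ≤ r) →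
      ∀ f : Ω2 → ℝ, Measurable f → (∀ z, 0 ≤ f z) → (∀ z, f z ≤ 1) →
      |∫ z, f z ∂ν - ∫ z, f z ∂ν'| ≤ 4 * r := by
    intro r hr f hf f0 f1
    have := abs_integral_tilted_sub_tilted_le lebSq hm hm' hb' hr hf f0 f1
    unfold IsSelfTilt at h h'
    rwa [h, h']
  have improve : ∀ D : ℝ, (∀ z, |invPot ν z - invPot ν' z| ≤ D) →
      ∀ z, |invPot ν z - invPot ν' z| ≤ 4 * (d + |s - s'| + D / 8) := fun D hD z =>
    cmp _ (step D hD) (invKer z) (measurable_invKer_right z) (invKer_nonneg z) (invKer_le_one z)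
  let D := sSup (Set.range fun z => |invPot ν z - invPot ν' z|)
  have hbdd : BddAbove (Set.range fun z => |invPot ν z - invPot ν' z|) := by
    refine ⟨1, ?_⟩
    rintro _ ⟨z, rfl⟩
    have := invPot_nonneg ν z
    have := invPot_le_one ν z
    have := invPot_nonneg ν' z
    have := invPot_le_one ν' z
    exact abs_le.2 ⟨by linarith, by linarith⟩
  have hD : ∀ z, |invPot ν z - invPot ν' z| ≤ D := fun z => le_csSup hbdd ⟨z, rfl⟩
  have hD' : D ≤ 4 * (d + |s - s'| + D / 8) :=
    csSup_le (Set.range_nonempty _) (by rintro _ ⟨z, rfl⟩; exact improve D hD z)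
  have hD8 : D ≤ 8 * (d + |s - s'|) := by linarith
  have h1 := cmp _ (step D hD) (invPot ν) (measurable_invPot ν) (invPot_nonneg ν)
    (invPot_le_one ν)
  have h2 : |∫ z, invPot ν z ∂ν' - ∫ z, invPot ν' z ∂ν'| ≤ D := by
    rw [← integral_sub (integrable_invPot _ _) (integrable_invPot _ _)]
    simpa using norm_integral_le_of_norm_le_const (μ := ν') (f := fun z => invPot ν z - invPot ν' z)
      (ae_of_all _ hD)
  rw [tPat_inv2, tPat_inv2]
  have := abs_sub_le (∫ z, invPot ν z ∂ν) (∫ z, invPot ν z ∂ν') (∫ z, invPot ν' z ∂ν')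
  linarith [abs_nonneg (s - s')]

lemma abs_tPat_quadratic_le {μ ν l : Measure Ω2} [IsProbabilityMeasure μ] [IsProbabilityMeasure ν]
    [IsProbabilityMeasure l] {f w : Ω2 → ℝ} (hf : Integrable f l) (hw : Integrable w l)
    (hν : ∀ h : Ω2 → ℝ, ∫ z, f z * h z ∂l = ∫ z, h z ∂ν)
    (hμ : ∀ h : Ω2 → ℝ, ∫ z, w z * h z ∂l = ∫ z, h z ∂μ) :
    |tPat inv2 ν - 2 * ∫ z, invPot μ z ∂ν + tPat inv2 μ| ≤ (∫ z, |f z - w z| ∂l) ^ 2 := by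
  have hi : Integrable (fun z => |f z - w z|) l := (hf.sub hw).abs
  have bound : ∀ h : Ω2 → ℝ, Measurable h → ∀ C, (∀ z, |h z| ≤ C) →
      |∫ z, h z ∂ν - ∫ z, h z ∂μ| ≤ C * ∫ z, |f z - w z| ∂l := by
    intro h hm C hC
    rw [← hν, ← hμ, ← integral_sub
      (hf.mul_bdd (c := C) hm.aestronglyMeasurable (ae_of_all _ hC))
      (hw.mul_bdd (c := C) hm.aestronglyMeasurable (ae_of_all _ hC)), ← integral_const_mul]
    have := norm_integral_le_of_norm_le (f := fun z => f z * h z - w z * h z)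
      (hi.const_mul C) (ae_of_all _ fun z => by
        rw [← sub_mul, norm_mul, mul_comm]
        exact mul_le_mul_of_nonneg_right (hC z) (norm_nonneg _))
    simpa only [Real.norm_eq_abs] using this
  rw [invPot_sub_quadratic, sq]
  refine bound _ ((measurable_invPot ν).sub (measurable_invPot μ)) _ fun z => ?_
  simpa [invPot] using bound (invKer z) (measurable_invKer_right z) 1 fun w => by
    rw [abs_of_nonneg (invKer_nonneg z w)]; exact invKer_le_one z w

lemma mul_log_add_one_sub_ge {f w : ℝ} (hf : 0 ≤ f) (hw : 0 < w) :
    (√f - √w) ^ 2 + f * Real.log w + 1 - w ≤ f * Real.log f + 1 - f := by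
  rcases hf.eq_or_lt with rfl | hf
  · simp [Real.sq_sqrt hw.le]
  · have h1 := Real.log_le_sub_one_of_pos (x := √w / √f) (by positivity)
    rw [Real.log_div (by positivity) (by positivity), Real.log_sqrt hw.le,
      Real.log_sqrt hf.le] at h1
    have h2 : f * (√w / √f) = √w * √f := by
      have := Real.mul_self_sqrt hf.le
      have h0 : √f ≠ 0 := by positivity
      field_simp
      nlinarith
    have h3 := mul_le_mul_of_nonneg_left h1 hf.le
    have h4 := Real.sq_sqrt hf.le
    have h5 := Real.sq_sqrt hw.le
    nlinarith

lemma mul_log_add_one_sub_nonneg {f : ℝ} (hf : 0 ≤ f) : 0 ≤ f * Real.log f + 1 - f := by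
  have := mul_log_add_one_sub_ge hf one_pos
  simp only [Real.log_one, mul_zero, add_zero] at this
  nlinarith [sq_nonneg (√f - √1)]

/-- Comparison of the total variation and Hellinger distances between densities. -/
lemma sq_integral_abs_sub_le {α : Type*} [MeasurableSpace α] {l : Measure α} {f w : α → ℝ}
    (hf : Integrable f l) (hw : Integrable w l) (f0 : ∀ z, 0 ≤ f z) (w0 : ∀ z, 0 ≤ w z)
    (f1 : ∫ z, f z ∂l = 1) (w1 : ∫ z, w z ∂l = 1)
    (hH : Integrable (fun z => (√(f z) - √(w z)) ^ 2) l) :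
    (∫ z, |f z - w z| ∂l) ^ 2 ≤ 4 * ∫ z, (√(f z) - √(w z)) ^ 2 ∂l := by
  set D := ∫ z, |f z - w z| ∂l with hD
  set H := ∫ z, (√(f z) - √(w z)) ^ 2 ∂l with hHd
  have hD0 : 0 ≤ D := integral_nonneg fun z => abs_nonneg _
  have hH0 : 0 ≤ H := integral_nonneg fun z => sq_nonneg _
  rcases hD0.eq_or_lt with h | h
  · rw [← h]; nlinarith
  have hk : ∀ c : ℝ, 0 < c → D ≤ c / 2 * H + 2 / c := by
    intro c hc
    have : D ≤ ∫ z, (c / 2 * (√(f z) - √(w z)) ^ 2 + 1 / c * (f z + w z)) ∂l := by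
      refine integral_mono (hf.sub hw).abs
        ((hH.const_mul _).add ((hf.add hw).const_mul _)) fun z => ?_
      have a1 := Real.sq_sqrt (f0 z)
      have a2 := Real.sq_sqrt (w0 z)
      have p1 := Real.sqrt_nonneg (f z)
      have p2 := Real.sqrt_nonneg (w z)
      have e : f z - w z = (√(f z) - √(w z)) * (√(f z) + √(w z)) := by ring_nf; rw [a1, a2]
      have e2 : f z + w z = √(f z) ^ 2 + √(w z) ^ 2 := by rw [a1, a2]
      simp only
      rw [e, e2, abs_mul, abs_of_nonneg (add_nonneg p1 p2), ← sq_abs (√(f z) - √(w z))]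
      generalize |√(f z) - √(w z)| = x
      generalize √(f z) = a at *
      generalize √(w z) = b at *
      have h2 : 0 ≤ (c * x - (a + b)) ^ 2 + (a - b) ^ 2 := by positivity
      rw [← sub_nonneg]
      have : c / 2 * x ^ 2 + 1 / c * (a ^ 2 + b ^ 2) - x * (a + b)
        = ((c * x - (a + b)) ^ 2 + (a - b) ^ 2) / (2 * c) := by field_simp; ring
      rw [this]; positivity
    have hfw : Integrable (fun z => f z + w z) l := hf.add hw
    rw [integral_add (hH.const_mul _) (hfw.const_mul _), integral_const_mul,
      integral_const_mul] at this
    have e : ∫ z, (f z + w z) ∂l = 2 := by rw [integral_add hf hw, f1, w1]; norm_num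
    rw [e] at this
    refine this.trans (le_of_eq ?_)
    ring
  have := hk (4 / D) (by positivity)
  have e : 4 / D / 2 * H + 2 / (4 / D) = (4 * H + D ^ 2) / (2 * D) := by field_simp; ring
  rw [e, le_div_iff₀ (by positivity)] at this
  nlinarith

lemma toEReal_sub_eq_of_ne_top {x : ℝ} {k : ℝ≥0∞} (hk : k ≠ ∞) :
    ((x : EReal) - (k : EReal)) = ((x - k.toReal : ℝ) : EReal) := by
  rw [← EReal.coe_ennreal_toReal hk, EReal.coe_sub]

/-- The value of the variational problem at a self-consistent tilt `ν`. -/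
def tiltValue (θ : ℝ) (ν : Measure Ω2) : ℝ :=
  Real.log (∫ z, Real.exp (2 * θ * invPot ν z) ∂lebSq) - θ * tPat inv2 ν

section Variational

variable {θ : ℝ} {ν₀ : Measure Ω2}

/-- Lebesgue density of a self-consistent tilt without external field. -/
def tiltDensity (θ : ℝ) (ν₀ : Measure Ω2) (z : Ω2) : ℝ :=
  Real.exp (2 * θ * invPot ν₀ z) / ∫ z, Real.exp (2 * θ * invPot ν₀ z) ∂lebSq

lemma integrable_exp_invPot [IsProbabilityMeasure ν₀] (s : ℝ) (μ : Measure Ω2)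
    [IsFiniteMeasure μ] : Integrable (fun z => Real.exp (s * invPot ν₀ z)) μ :=
  integrable_exp_of_abs_le ((measurable_invPot ν₀).const_mul _) (C := |s|) fun z => by
    rw [abs_mul, abs_of_nonneg (invPot_nonneg _ _)]
    exact mul_le_of_le_one_right (abs_nonneg _) (invPot_le_one _ _)

lemma tiltDensity_pos [IsProbabilityMeasure ν₀] (z : Ω2) : 0 < tiltDensity θ ν₀ z :=
  div_pos (Real.exp_pos _) (integral_exp_pos (integrable_exp_invPot _ _))

lemma log_tiltDensity [IsProbabilityMeasure ν₀] (z : Ω2) :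
    Real.log (tiltDensity θ ν₀ z) = 2 * θ * invPot ν₀ z -
      Real.log (∫ z, Real.exp (2 * θ * invPot ν₀ z) ∂lebSq) := by
  rw [tiltDensity, Real.log_div (Real.exp_pos _).ne'
    (integral_exp_pos (integrable_exp_invPot _ _)).ne', Real.log_exp]

lemma measurable_tiltDensity [IsProbabilityMeasure ν₀] : Measurable (tiltDensity θ ν₀) :=
  (((measurable_invPot ν₀).const_mul _).exp).div_const _

lemma integrable_tiltDensity [IsProbabilityMeasure ν₀] : Integrable (tiltDensity θ ν₀) lebSq :=
  (integrable_exp_invPot _ _).div_const _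

lemma IsSelfTilt.eq_tilted (h : IsSelfTilt (fun _ => 0) (2 * θ) ν₀) :
    ν₀ = lebSq.tilted (fun z => 2 * θ * invPot ν₀ z) := by
  unfold IsSelfTilt at h
  simpa only [zero_add] using h

lemma IsSelfTilt.integral_tiltDensity_mul (h : IsSelfTilt (fun _ => 0) (2 * θ) ν₀) (k : Ω2 → ℝ) :
    ∫ z, tiltDensity θ ν₀ z * k z ∂lebSq = ∫ z, k z ∂ν₀ := by
  conv_rhs => rw [h.eq_tilted, integral_tilted]
  rfl

lemma IsSelfTilt.integral_tiltDensity [IsProbabilityMeasure ν₀]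
    (h : IsSelfTilt (fun _ => 0) (2 * θ) ν₀) : ∫ z, tiltDensity θ ν₀ z ∂lebSq = 1 := by
  simpa using h.integral_tiltDensity_mul (fun _ => 1)

lemma integral_log_tiltDensity [IsProbabilityMeasure ν₀] (ν : Measure Ω2)
    [IsProbabilityMeasure ν] :
    ∫ z, Real.log (tiltDensity θ ν₀ z) ∂ν = 2 * θ * ∫ z, invPot ν₀ z ∂ν -
      Real.log (∫ z, Real.exp (2 * θ * invPot ν₀ z) ∂lebSq) := by
  simp only [log_tiltDensity]
  rw [integral_sub ((integrable_invPot _ _).const_mul _) (integrable_const _),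
    integral_const_mul]
  simp

lemma abs_log_tiltDensity_le [IsProbabilityMeasure ν₀] (z : Ω2) :
    |Real.log (tiltDensity θ ν₀ z)| ≤ |2 * θ| +
      |Real.log (∫ z, Real.exp (2 * θ * invPot ν₀ z) ∂lebSq)| := by
  rw [log_tiltDensity]
  refine (abs_sub _ _).trans (add_le_add ?_ le_rfl)
  rw [abs_mul, abs_of_nonneg (invPot_nonneg _ _)]
  exact mul_le_of_le_one_right (abs_nonneg _) (invPot_le_one _ _)

lemma IsSelfTilt.KL_eq [IsProbabilityMeasure ν₀] (h : IsSelfTilt (fun _ => 0) (2 * θ) ν₀) :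
    KL ν₀ lebSq ≠ ∞ ∧ θ * tPat inv2 ν₀ - (KL ν₀ lebSq).toReal = tiltValue θ ν₀ := by
  have hac : ν₀ ≪ lebSq := by
    conv_lhs => rw [h.eq_tilted]
    exact tilted_absolutelyContinuous _ _
  have hrn : ν₀.rnDeriv lebSq =ᵐ[lebSq] fun z => ENNReal.ofReal (tiltDensity θ ν₀ z) := by
    conv_lhs => rw [h.eq_tilted]
    exact rnDeriv_tilted_left_self ((measurable_invPot ν₀).const_mul _).aemeasurable
  have hKL : KL ν₀ lebSq = ∫⁻ z, ENNReal.ofReal (tiltDensity θ ν₀ z *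
      Real.log (tiltDensity θ ν₀ z) + 1 - tiltDensity θ ν₀ z) ∂lebSq := by
    rw [KL, if_pos hac]
    refine lintegral_congr_ae ?_
    filter_upwards [hrn] with z hz
    rw [hz, ENNReal.toReal_ofReal (tiltDensity_pos z).le]
  have hi : Integrable (fun z => tiltDensity θ ν₀ z * Real.log (tiltDensity θ ν₀ z)) lebSq :=
    integrable_tiltDensity.mul_bdd (c := |2 * θ| +
      |Real.log (∫ z, Real.exp (2 * θ * invPot ν₀ z) ∂lebSq)|)
      measurable_tiltDensity.log.aestronglyMeasurable (ae_of_all _ abs_log_tiltDensity_le)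
  have hi1 : Integrable (fun z => tiltDensity θ ν₀ z * Real.log (tiltDensity θ ν₀ z) + 1) lebSq :=
    hi.add (integrable_const (1 : ℝ))
  have hi2 : Integrable (fun z => tiltDensity θ ν₀ z * Real.log (tiltDensity θ ν₀ z) + 1
      - tiltDensity θ ν₀ z) lebSq := hi1.sub integrable_tiltDensity
  have h0 : ∀ z, 0 ≤ tiltDensity θ ν₀ z * Real.log (tiltDensity θ ν₀ z) + 1
      - tiltDensity θ ν₀ z := fun z => mul_log_add_one_sub_nonneg (tiltDensity_pos z).le
  have hKL2 : KL ν₀ lebSq = ENNReal.ofReal (∫ z, (tiltDensity θ ν₀ z *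
      Real.log (tiltDensity θ ν₀ z) + 1 - tiltDensity θ ν₀ z) ∂lebSq) := by
    rw [hKL, ofReal_integral_eq_lintegral_ofReal hi2 (ae_of_all _ h0)]
  refine ⟨by rw [hKL2]; exact ENNReal.ofReal_ne_top, ?_⟩
  rw [hKL2, ENNReal.toReal_ofReal (integral_nonneg h0),
    integral_sub hi1 integrable_tiltDensity,
    integral_add hi (integrable_const _), h.integral_tiltDensity, h.integral_tiltDensity_mul,
    integral_log_tiltDensity, tiltValue, tPat_inv2]
  simp
  ring

lemma IsSelfTilt.value_le [IsProbabilityMeasure ν₀] (h : IsSelfTilt (fun _ => 0) (2 * θ) ν₀)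
    (hθ : |θ| ≤ 1 / 16) (ν : Measure Ω2) [IsProbabilityMeasure ν] (hKL : KL ν lebSq ≠ ∞) :
    θ * tPat inv2 ν - (KL ν lebSq).toReal ≤ tiltValue θ ν₀ ∧
    (θ * tPat inv2 ν - (KL ν lebSq).toReal = tiltValue θ ν₀ → ν = ν₀) := by
  have hac : ν ≪ lebSq := by
    by_contra hn
    exact hKL (by rw [KL, if_neg hn])
  rw [KL, if_pos hac] at hKL ⊢
  set f : Ω2 → ℝ := fun z => (ν.rnDeriv lebSq z).toReal with hf
  set w := tiltDensity θ ν₀ with hw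
  have f0 : ∀ z, 0 ≤ f z := fun z => ENNReal.toReal_nonneg
  have w0 : ∀ z, 0 < w z := tiltDensity_pos
  have fm : Measurable f := (Measure.measurable_rnDeriv _ _).ennreal_toReal
  have wm : Measurable w := measurable_tiltDensity
  have fi : Integrable f lebSq := Measure.integrable_toReal_rnDeriv
  have wi : Integrable w lebSq := integrable_tiltDensity
  have hfν : ∀ k : Ω2 → ℝ, ∫ z, f z * k z ∂lebSq = ∫ z, k z ∂ν := fun k =>
    integral_rnDeriv_smul (f := k) hac
  have f1 : ∫ z, f z ∂lebSq = 1 := by simpa using hfν (fun _ => 1)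
  have w1 : ∫ z, w z ∂lebSq = 1 := h.integral_tiltDensity
  have φ0 : ∀ z, 0 ≤ f z * Real.log (f z) + 1 - f z := fun z =>
    mul_log_add_one_sub_nonneg (f0 z)
  have φm : Measurable (fun z => f z * Real.log (f z) + 1 - f z) :=
    ((fm.mul fm.log).add_const 1).sub fm
  have φi : Integrable (fun z => f z * Real.log (f z) + 1 - f z) lebSq :=
    (lintegral_ofReal_ne_top_iff_integrable φm.aestronglyMeasurable (ae_of_all _ φ0)).1 hKL
  have hr := integral_eq_lintegral_of_nonneg_ae (ae_of_all lebSq φ0) φm.aestronglyMeasurable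
  rw [← hr]
  have hH : Integrable (fun z => (√(f z) - √(w z)) ^ 2) lebSq := by
    refine (fi.add wi).mono' ((fm.sqrt.sub wm.sqrt).pow_const 2).aestronglyMeasurable
      (ae_of_all _ fun z => ?_)
    rw [Real.norm_of_nonneg (sq_nonneg _)]
    have a1 := Real.sq_sqrt (f0 z)
    have a2 := Real.sq_sqrt (w0 z).le
    have p1 := mul_nonneg (Real.sqrt_nonneg (f z)) (Real.sqrt_nonneg (w z))
    simp only [Pi.add_apply]
    nlinarith
  have li : Integrable (fun z => f z * Real.log (w z)) lebSq :=
    fi.mul_bdd (c := |2 * θ| + |Real.log (∫ z, Real.exp (2 * θ * invPot ν₀ z) ∂lebSq)|)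
      wm.log.aestronglyMeasurable (ae_of_all _ abs_log_tiltDensity_le)
  have hge := integral_mono (((hH.add li).add (integrable_const (1 : ℝ))).sub wi) φi
    (fun z => mul_log_add_one_sub_ge (f0 z) (w0 z))
  rw [integral_sub' ((hH.add li).add (integrable_const (1 : ℝ))) wi,
    integral_add' (hH.add li) (integrable_const (1 : ℝ)), integral_add' hH li, hfν, w1,
    integral_log_tiltDensity] at hge
  have hD := sq_integral_abs_sub_le fi wi f0 (fun z => (w0 z).le) f1 w1 hH
  have hQ := abs_tPat_quadratic_le fi wi hfν h.integral_tiltDensity_mul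
  set H := ∫ z, (√(f z) - √(w z)) ^ 2 ∂lebSq
  have hH0 : 0 ≤ H := integral_nonneg fun z => sq_nonneg _
  have hQ2 : θ * (tPat inv2 ν - 2 * ∫ z, invPot ν₀ z ∂ν + tPat inv2 ν₀) ≤ 1 / 16 * (4 * H) := by
    refine (le_abs_self _).trans ?_
    rw [abs_mul]
    exact mul_le_mul hθ (hQ.trans hD) (abs_nonneg _) (by norm_num)
  simp only [integral_const, probReal_univ, smul_eq_mul, mul_one] at hge
  have main : θ * tPat inv2 ν - ∫ z, (f z * Real.log (f z) + 1 - f z) ∂lebSq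
      ≤ tiltValue θ ν₀ - 3 / 4 * H := by
    unfold tiltValue
    linarith
  refine ⟨by linarith, fun heq => ?_⟩
  have hH00 : H = 0 := by linarith
  have hD0 : ∫ z, |f z - w z| ∂lebSq = 0 := by
    rw [hH00, mul_zero] at hD
    exact pow_eq_zero_iff (two_ne_zero) |>.1 (le_antisymm hD (sq_nonneg _))
  have hae := (integral_eq_zero_iff_of_nonneg (fun z => abs_nonneg _) (fi.sub wi).abs).1 hD0
  refine Measure.ext fun A hA => ?_
  have : ∫ z, A.indicator 1 z ∂ν = ∫ z, A.indicator (1 : Ω2 → ℝ) z ∂ν₀ := by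
    rw [← hfν, ← h.integral_tiltDensity_mul]
    refine integral_congr_ae ?_
    filter_upwards [hae] with z hz
    rw [show f z = w z from sub_eq_zero.1 (abs_eq_zero.1 hz)]
  rw [integral_indicator_one hA, integral_indicator_one hA] at this
  exact (ENNReal.toReal_eq_toReal_iff' (measure_ne_top _ _) (measure_ne_top _ _)).1 this

lemma mem_Mcal_of_ac (ν : ProbabilityMeasure Ω2) (h : (ν : Measure Ω2) ≪ lebSq) : ν ∈ Mcal := by
  refine ⟨?_, fun x => ?_, fun y => ?_⟩
  · have hs : MeasurableSet unitSq := measurableSet_Icc.prod measurableSet_Icc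
    refine (prob_compl_eq_zero_iff hs).1 (h ?_)
    rw [lebSq, Measure.restrict_apply hs.compl]
    simp
  · rw [Measure.map_apply measurable_fst (measurableSet_singleton x)]
    exact h (lebSq_fst_eq x)
  · rw [Measure.map_apply measurable_snd (measurableSet_singleton y)]
    exact h (lebSq_snd_eq y)

lemma IsSelfTilt.Fset_eq {νθ : ProbabilityMeasure Ω2}
    (h : IsSelfTilt (fun _ => 0) (2 * θ) (νθ : Measure Ω2)) (hθ : |θ| ≤ 1 / 16) :
    Fset inv2 lebSq θ = {νθ} := by
  have hac : (νθ : Measure Ω2) ≪ lebSq := by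
    conv_lhs => rw [h.eq_tilted]
    exact tilted_absolutelyContinuous _ _
  have hmem := mem_Mcal_of_ac νθ hac
  have hval : (((θ * tPat inv2 (νθ : Measure Ω2) : ℝ) : EReal) -
      ((KL (↑νθ) lebSq : ℝ≥0∞) : EReal)) = (tiltValue θ νθ : EReal) := by
    rw [toEReal_sub_eq_of_ne_top h.KL_eq.1, h.KL_eq.2]
  have hF : Fsup inv2 lebSq θ = (tiltValue θ νθ : EReal) := by
    refine le_antisymm (iSup₂_le fun ν _ => ?_) (hval ▸ le_iSup₂_of_le νθ hmem le_rfl)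
    by_cases hk : KL (↑ν) lebSq = ∞
    · rw [hk, EReal.coe_ennreal_top, EReal.sub_top]; exact bot_le
    · rw [toEReal_sub_eq_of_ne_top hk]
      exact EReal.coe_le_coe_iff.2 (h.value_le hθ ν hk).1
  ext ν
  simp only [Fset, Set.mem_ofPred_eq, Set.mem_singleton_iff, hF]
  constructor
  · rintro ⟨-, hv⟩
    have hk : KL (↑ν) lebSq ≠ ∞ := by
      intro hk
      rw [hk, EReal.coe_ennreal_top, EReal.sub_top] at hv
      exact EReal.bot_ne_coe _ hv
    rw [toEReal_sub_eq_of_ne_top hk, EReal.coe_eq_coe_iff] at hv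
    exact Subtype.ext ((h.value_le hθ ν hk).2 hv)
  · rintro rfl
    exact ⟨hmem, hval⟩

end Variational

lemma measurableSet_unitSq : MeasurableSet unitSq := measurableSet_Icc.prod measurableSet_Icc

lemma lebSq_eq_prod : lebSq = unif01.prod unif01 := by
  rw [lebSq, unif01, Measure.prod_restrict]; rfl

lemma unitSq_subset_closure_interior : unitSq ⊆ closure (interior unitSq) := by
  rw [unitSq, interior_prod_eq, closure_prod_eq, interior_Icc,
    closure_Ioo (zero_ne_one' ℝ)]

lemma ae_mem_Ioo_of_ac {ν : Measure Ω2} (h : ν ≪ lebSq) :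
    ∀ᵐ w ∂ν, (0 < w.1 ∧ w.1 < 1) ∧ 0 < w.2 ∧ w.2 < 1 := by
  have hne : ∀ x : ℝ, (∀ᵐ w ∂ν, w.1 ≠ x) ∧ ∀ᵐ w ∂ν, w.2 ≠ x := fun x =>
    ⟨measure_eq_zero_iff_ae_notMem.1 (h (lebSq_fst_eq x)),
      measure_eq_zero_iff_ae_notMem.1 (h (lebSq_snd_eq x))⟩
  have hm : ∀ᵐ w ∂ν, w ∈ unitSq := h.ae_le (ae_restrict_mem measurableSet_unitSq)
  filter_upwards [hm, (hne 0).1, (hne 0).2, (hne 1).1, (hne 1).2] with w hw h1 h2 h3 h4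
  exact ⟨⟨lt_of_le_of_ne hw.1.1 h1.symm, lt_of_le_of_ne hw.1.2 h3⟩,
    lt_of_le_of_ne hw.2.1 h2.symm, lt_of_le_of_ne hw.2.2 h4⟩

lemma invPot_eq_rect {ν : Measure Ω2} [IsProbabilityMeasure ν] (h : ν ≪ lebSq) (x y : ℝ) :
    invPot ν (x, y) = ν.real (Set.Iio 1 ×ˢ Set.Iio y) + ν.real (Set.Iio x ×ˢ Set.Iio 1)
      - 2 * ν.real (Set.Iio x ×ˢ Set.Iio y) := by
  have hm : ∀ a b : ℝ, MeasurableSet (Set.Iio a ×ˢ Set.Iio b) := fun a b =>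
    measurableSet_Iio.prod measurableSet_Iio
  have hi : ∀ a b : ℝ, Integrable ((Set.Iio a ×ˢ Set.Iio b).indicator (1 : Ω2 → ℝ)) ν :=
    fun a b => (integrable_const (1 : ℝ)).indicator (hm a b)
  rw [← integral_indicator_one (hm 1 y), ← integral_indicator_one (hm x 1),
    ← integral_indicator_one (hm x y), ← integral_const_mul, ← integral_add (hi _ _) (hi _ _),
    ← integral_sub (f := fun w => (Set.Iio 1 ×ˢ Set.Iio y).indicator (1 : Ω2 → ℝ) w
      + (Set.Iio x ×ˢ Set.Iio 1).indicator (1 : Ω2 → ℝ) w)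
      ((hi 1 y).add (hi x 1)) ((hi x y).const_mul 2)]
  refine integral_congr_ae ?_
  have hx' : ∀ᵐ w ∂ν, w.1 ≠ x := measure_eq_zero_iff_ae_notMem.1 (h (lebSq_fst_eq x))
  have hy' : ∀ᵐ w ∂ν, w.2 ≠ y := measure_eq_zero_iff_ae_notMem.1 (h (lebSq_snd_eq y))
  filter_upwards [ae_mem_Ioo_of_ac h, hx', hy'] with w ⟨⟨h1, h2⟩, h3, h4⟩ h5 h6
  have e : ∀ a b : ℝ, (Set.Iio a ×ˢ Set.Iio b).indicator (1 : Ω2 → ℝ) w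
      = if w.1 < a ∧ w.2 < b then 1 else 0 := fun a b => by
    simp only [Set.indicator_apply, Set.mem_prod, Set.mem_Iio, Pi.one_apply]
  simp only [invKer, e, h2, h4, true_and, and_true]
  rcases lt_or_gt_of_ne h5 with hx0 | hx0 <;> rcases lt_or_gt_of_ne h6 with hy0 | hy0
  · rw [if_neg (not_lt.2 (mul_pos (sub_pos.2 hx0) (sub_pos.2 hy0)).le)]
    simp [hx0, hy0]; norm_num
  · rw [if_pos (mul_neg_of_pos_of_neg (sub_pos.2 hx0) (sub_neg.2 hy0))]
    simp [hx0, hy0.not_gt]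
  · rw [if_pos (mul_neg_of_neg_of_pos (sub_neg.2 hx0) (sub_pos.2 hy0))]
    simp [hx0.not_gt, hy0]
  · rw [if_neg (not_lt.2 (mul_pos_of_neg_of_neg (sub_neg.2 hx0) (sub_neg.2 hy0)).le)]
    simp [hx0.not_gt, hy0.not_gt]

lemma measureReal_rect_zero_left {ν : Measure Ω2} (h : ν ≪ lebSq) (y : ℝ) :
    ν.real (Set.Iio 0 ×ˢ Set.Iio y) = 0 := by
  rw [measureReal_def, measure_eq_zero_iff_ae_notMem.2, ENNReal.toReal_zero]
  filter_upwards [ae_mem_Ioo_of_ac h] with w hw hc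
  exact hw.1.1.not_gt hc.1

lemma measureReal_rect_zero_right {ν : Measure Ω2} (h : ν ≪ lebSq) (x : ℝ) :
    ν.real (Set.Iio x ×ˢ Set.Iio 0) = 0 := by
  rw [measureReal_def, measure_eq_zero_iff_ae_notMem.2, ENNReal.toReal_zero]
  filter_upwards [ae_mem_Ioo_of_ac h] with w hw hc
  exact hw.2.1.not_gt hc.2

lemma measureReal_rect_one {ν : Measure Ω2} [IsProbabilityMeasure ν] (h : ν ≪ lebSq) :
    ν.real (Set.Iio 1 ×ˢ Set.Iio 1) = 1 := by
  rw [measureReal_def, (prob_compl_eq_zero_iff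
    (measurableSet_Iio.prod measurableSet_Iio)).1, ENNReal.toReal_one]
  refine measure_eq_zero_iff_ae_notMem.2 ?_
  filter_upwards [ae_mem_Ioo_of_ac h] with w hw hc
  exact hc ⟨hw.1.2, hw.2.2⟩

lemma IsSelfTilt.ac {g : Ω2 → ℝ} {s : ℝ} {ν : Measure Ω2} (h : IsSelfTilt g s ν) :
    ν ≪ lebSq := by
  unfold IsSelfTilt at h
  conv_lhs => rw [h]
  exact tilted_absolutelyContinuous _ _

lemma measurePreserving_reflect :
    MeasurePreserving (fun z : Ω2 => (z.1, 1 - z.2)) lebSq lebSq := by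
  have h1 : MeasurePreserving (fun z : Ω2 => (z.1, 1 - z.2)) volume volume :=
    (MeasurePreserving.id volume).prod (Measure.measurePreserving_sub_left volume (1 : ℝ))
  have h2 := h1.restrict_preimage measurableSet_unitSq
  have e : (fun z : Ω2 => (z.1, 1 - z.2)) ⁻¹' unitSq = unitSq := by
    ext z
    simp only [unitSq, Set.mem_preimage, Set.mem_prod, Set.mem_Icc]
    constructor <;> rintro ⟨⟨h1, h2⟩, h3, h4⟩ <;> refine ⟨⟨h1, h2⟩, ?_, ?_⟩ <;> linarith
  rwa [e] at h2

lemma tPat_inv2_lebSq : tPat inv2 lebSq = 1 / 2 := by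
  set R : Ω2 → Ω2 := fun z => (z.1, 1 - z.2) with hRdef
  have hR : MeasurePreserving R lebSq lebSq := measurePreserving_reflect
  have comp : ∀ f : Ω2 → ℝ, Measurable f → ∫ w, f (R w) ∂lebSq = ∫ w, f w ∂lebSq := by
    intro f hf
    conv_rhs => rw [← hR.map_eq]
    rw [integral_map hR.measurable.aemeasurable hf.aestronglyMeasurable]
  have hpot : ∀ z, invPot lebSq (R z) = 1 - invPot lebSq z := by
    intro z
    have h1 : invPot lebSq (R z) = ∫ w, invKer (R z) (R w) ∂lebSq :=
      (comp _ (measurable_invKer_right (R z))).symm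
    have h2 : (1 : ℝ) - invPot lebSq z = ∫ w, (1 - invKer z w) ∂lebSq := by
      rw [integral_sub (integrable_const _) (integrable_invKer_right _ _)]
      simp [invPot]
    rw [h1, h2]
    refine integral_congr_ae ?_
    have hx' : ∀ᵐ w ∂lebSq, w.1 ≠ z.1 := measure_eq_zero_iff_ae_notMem.1 (lebSq_fst_eq z.1)
    have hy' : ∀ᵐ w ∂lebSq, w.2 ≠ z.2 := measure_eq_zero_iff_ae_notMem.1 (lebSq_snd_eq z.2)
    filter_upwards [hx', hy'] with w h5 h6
    have e : (z.1 - w.1) * (1 - z.2 - (1 - w.2)) = -((z.1 - w.1) * (z.2 - w.2)) := by ring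
    have hne : (z.1 - w.1) * (z.2 - w.2) ≠ 0 :=
      mul_ne_zero (sub_ne_zero.2 h5.symm) (sub_ne_zero.2 h6.symm)
    simp only [invKer, hRdef, e, Left.neg_neg_iff]
    rcases lt_or_gt_of_ne hne with h | h
    · rw [if_neg h.not_gt, if_pos h]; norm_num
    · rw [if_pos h, if_neg h.not_gt]; norm_num
  rw [tPat_inv2]
  have h3 := comp _ (measurable_invPot lebSq)
  simp only [hpot] at h3
  rw [integral_sub (integrable_const _) (integrable_invPot _ _)] at h3
  simp at h3
  linarith

lemma KL_self (μ : Measure Ω2) [SigmaFinite μ] : KL μ μ = 0 := by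
  rw [KL, if_pos Measure.AbsolutelyContinuous.rfl, lintegral_eq_zero_iff' (by fun_prop)]
  filter_upwards [Measure.rnDeriv_self μ] with z hz
  simp [hz]

lemma IsSelfTilt.ne_lebSq {θ : ℝ} {ν : Measure Ω2} [IsProbabilityMeasure ν]
    (h : IsSelfTilt (fun _ => 0) (2 * θ) ν) (hθ : θ ≠ 0) : ν ≠ lebSq := by
  intro hν
  have h1 := rnDeriv_tilted_left_self (μ := lebSq) (f := fun z => 2 * θ * invPot ν z)
    ((measurable_invPot ν).const_mul _).aemeasurable
  rw [← h.eq_tilted] at h1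
  have h2 : ν.rnDeriv lebSq =ᵐ[lebSq] fun _ => 1 := by
    rw [hν]; exact Measure.rnDeriv_self lebSq
  have h3 : tiltDensity θ ν =ᵐ[lebSq] fun _ => 1 := by
    filter_upwards [h1, h2] with z a b
    rw [b] at a
    exact (ENNReal.ofReal_eq_one.1 a.symm)
  have hc : Continuous (tiltDensity θ ν) :=
    ((continuous_invPot_of_ac h.ac).const_mul _).rexp.div_const _
  have h4 := Measure.eqOn_of_ae_eq h3 hc.continuousOn continuousOn_const
    unitSq_subset_closure_interior
  have m0 : (0 : ℝ) ∈ Set.Icc (0 : ℝ) 1 := by simp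
  have m1 : (1 : ℝ) ∈ Set.Icc (0 : ℝ) 1 := by simp
  have e0 := h4 (Set.mk_mem_prod m0 m0)
  have e1 := h4 (Set.mk_mem_prod m0 m1)
  have hZ := integral_exp_pos (integrable_exp_invPot (ν₀ := ν) (2 * θ) lebSq)
  simp only [tiltDensity, invPot_eq_rect h.ac 0 0, invPot_eq_rect h.ac 0 1,
    measureReal_rect_zero_left h.ac, measureReal_rect_zero_right h.ac,
    measureReal_rect_one h.ac] at e0 e1
  rw [div_eq_one_iff_eq hZ.ne'] at e0 e1
  rw [← e0, Real.exp_eq_exp] at e1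
  norm_num at e1
  exact hθ e1

lemma IsSelfTilt.half_lt {θ : ℝ} {ν : Measure Ω2} [IsProbabilityMeasure ν]
    (h : IsSelfTilt (fun _ => 0) (2 * θ) ν) (hθ : |θ| ≤ 1 / 16) (h0 : θ ≠ 0) :
    θ / 2 < θ * tPat inv2 ν := by
  have h1 := h.value_le hθ lebSq (by rw [KL_self]; exact ENNReal.zero_ne_top)
  rw [KL_self, tPat_inv2_lebSq, ENNReal.toReal_zero, sub_zero] at h1
  have h2 : θ * (1 / 2) < tiltValue θ ν :=
    lt_of_le_of_ne h1.1 fun he => h.ne_lebSq h0 (h1.2 he).symm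
  have h3 := h.KL_eq.2
  have h4 : 0 ≤ (KL ν lebSq).toReal := ENNReal.toReal_nonneg
  linarith

/-- For small coupling, the free self-consistent tilt has inversion density above `1/2`, and a
negative coupling in its external field produces a self-consistent tilt of inversion density
exactly `1/2`. -/
lemma exists_balanced_tilt : ∃ θc > (0 : ℝ), ∀ θ ∈ Set.Ioo (0 : ℝ) θc,
    ∃ νθ ν' : Measure Ω2, ∃ η : ℝ, IsProbabilityMeasure νθ ∧ IsProbabilityMeasure ν' ∧
      θ ≤ 1 / 16 ∧ 0 < η ∧ η ≤ 1 / 16 ∧ IsSelfTilt (fun _ => 0) (2 * θ) νθ ∧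
      IsSelfTilt (fun z => 2 * θ * invPot νθ z) (-2 * η) ν' ∧
      1 / 2 < tPat inv2 νθ ∧ tPat inv2 ν' = 1 / 2 := by
  obtain ⟨μ, hμp, hμ⟩ := exists_isSelfTilt (g := fun _ => 0) (C := 0) (s := 2 * (-(1 / 16)))
    measurable_const (by simp) (by norm_num [abs_of_nonneg])
  have hμt := hμ.half_lt (by norm_num [abs_of_nonneg]) (by norm_num)
  refine ⟨min (1 / 16) ((1 / 2 - tPat inv2 μ) / 40), by
    refine lt_min (by norm_num) (div_pos ?_ (by norm_num)); linarith, fun θ hθ => ?_⟩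
  have hθ0 := hθ.1
  have hθ1 : θ ≤ 1 / 16 := hθ.2.le.trans (min_le_left _ _)
  have hθ2 : θ < (1 / 2 - tPat inv2 μ) / 40 := hθ.2.trans_le (min_le_right _ _)
  have habs : |θ| ≤ 1 / 16 := by rwa [abs_of_pos hθ0]
  obtain ⟨νθ, hp, hν⟩ := exists_isSelfTilt (g := fun _ => 0) (C := 0) (s := 2 * θ)
    measurable_const (by simp) (by rw [abs_of_pos (by linarith)]; linarith)
  have hνt : 1 / 2 < tPat inv2 νθ := by
    have := hν.half_lt habs hθ0.ne'
    nlinarith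
  set g : Ω2 → ℝ := fun z => 2 * θ * invPot νθ z with hgdef
  have hgm : Measurable g := (measurable_invPot νθ).const_mul _
  have hgC : ∀ z, |g z| ≤ 2 * θ := fun z => by
    rw [hgdef, abs_mul, abs_of_nonneg (invPot_nonneg _ _), abs_of_pos (by linarith)]
    exact mul_le_of_le_one_right (by linarith) (invPot_le_one _ _)
  have hs : ∀ s ∈ Set.Icc (0 : ℝ) (1 / 16), |-2 * s| ≤ 1 / 8 := by
    intro s hs
    rw [abs_mul, abs_of_nonneg hs.1]; norm_num; linarith [hs.2]
  have hex : ∀ s : ℝ, ∃ ν : Measure Ω2, s ∈ Set.Icc (0 : ℝ) (1 / 16) →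
      IsProbabilityMeasure ν ∧ IsSelfTilt g (-2 * s) ν := by
    intro s
    by_cases hm : s ∈ Set.Icc (0 : ℝ) (1 / 16)
    · obtain ⟨ν, h⟩ := exists_isSelfTilt hgm hgC (hs s hm)
      exact ⟨ν, fun _ => h⟩
    · exact ⟨0, fun h => absurd h hm⟩
  choose κ hκ using hex
  have hcont : ContinuousOn (fun s => tPat inv2 (κ s)) (Set.Icc (0 : ℝ) (1 / 16)) := by
    refine LipschitzOnWith.continuousOn (K := 40) (LipschitzOnWith.of_dist_le_mul ?_)
    intro a ha b hb
    have := (hκ a ha).1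
    have := (hκ b hb).1
    rw [Real.dist_eq, Real.dist_eq]
    refine ((hκ a ha).2.abs_tPat_sub_le (hκ b hb).2 hgm hgm hgC (d := 0) (by simp)
      (hs a ha)).trans (le_of_eq ?_)
    rw [← mul_sub, abs_mul]
    norm_num
    ring
  have m0 : (0 : ℝ) ∈ Set.Icc (0 : ℝ) (1 / 16) := by norm_num
  have m1 : (1 / 16 : ℝ) ∈ Set.Icc (0 : ℝ) (1 / 16) := by norm_num
  have hleft : 1 / 2 < tPat inv2 (κ 0) := by
    have := (hκ 0 m0).1
    have hself : IsSelfTilt g 0 νθ := by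
      unfold IsSelfTilt
      simpa using hν.eq_tilted
    have h0 := (hκ 0 m0).2
    rw [mul_zero] at h0
    have h1 := h0.abs_tPat_sub_le hself hgm hgm hgC (d := 0) (by simp) (by norm_num)
    have h2 := abs_le.1 h1
    norm_num at h2
    linarith [h2.1]
  have hright : tPat inv2 (κ (1 / 16)) < 1 / 2 := by
    have := (hκ (1 / 16) m1).1
    have h1 := (hκ (1 / 16) m1).2.abs_tPat_sub_le hμ hgm measurable_const (C := 0) (d := 2 * θ)
      (by simp) (by simpa using hgC) (hs _ m1)
    have h2 := (abs_le.1 h1).2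
    norm_num at h2
    linarith
  obtain ⟨η, hη, hηt⟩ := intermediate_value_Icc' (by norm_num : (0 : ℝ) ≤ 1 / 16) hcont
    ⟨hright.le, hleft.le⟩
  have hη0 : η ≠ 0 := by
    rintro rfl
    exact hleft.ne' hηt
  exact ⟨νθ, κ η, η, hp, (hκ η hη).1, hθ1, lt_of_le_of_ne hη.1 hη0.symm, hη.2, hν,
    (hκ η hη).2, hνt, hηt⟩

section MarginalCDF

variable {m : Measure ℝ} [IsProbabilityMeasure m]

lemma monotone_measureReal_Iic : Monotone fun x => m.real (Set.Iic x) :=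
  fun _ _ h => measureReal_mono (Set.Iic_subset_Iic.2 h)

lemma ae_mem_Ioo_of_ac_unif01 {m : Measure ℝ} (h : m ≪ unif01) :
    ∀ᵐ x ∂m, x ∈ Set.Ioo (0 : ℝ) 1 := by
  refine h.ae_le ?_
  rw [unif01, ← restrict_Ioo_eq_restrict_Icc]
  exact ae_restrict_mem measurableSet_Ioo

lemma noAtoms_of_ac_unif01 {m : Measure ℝ} (h : m ≪ unif01) (x : ℝ) : m {x} = 0 :=
  h (by rw [unif01]; exact measure_singleton x)

lemma continuous_measureReal_Iic (h : m ≪ unif01) :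
    Continuous fun x => m.real (Set.Iic x) := by
  have e : (fun x => m.real (Set.Iic x))
      = fun x => ∫ w, (Set.Iic x).indicator (1 : ℝ → ℝ) w ∂m := by
    ext x; rw [integral_indicator_one measurableSet_Iic]
  rw [e, continuous_iff_continuousAt]
  intro x
  refine tendsto_integral_filter_of_dominated_convergence (fun _ => 1)
    (Eventually.of_forall fun y =>
      (measurable_one.indicator measurableSet_Iic).aestronglyMeasurable)
    (Eventually.of_forall fun y => ae_of_all _ fun w => ?_) (integrable_const _) ?_
  · by_cases hw : w ∈ Set.Iic y <;> simp [hw]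
  · have hx : ∀ᵐ w ∂m, w ≠ x := measure_eq_zero_iff_ae_notMem.1 (noAtoms_of_ac_unif01 h x)
    filter_upwards [hx] with w hw
    refine tendsto_const_nhds.congr' ?_
    rcases lt_or_gt_of_ne hw with hlt | hlt
    · filter_upwards [lt_mem_nhds hlt] with y hy
      simp [hy.le, hlt.le]
    · filter_upwards [gt_mem_nhds hlt] with y hy
      simp [hy.not_ge, hlt.not_ge]

lemma measureReal_Iic_lt (h : unif01 ≪ m) {a x : ℝ} (hx : x ∈ Set.Ioo (0 : ℝ) 1) (hax : a < x) :
    m.real (Set.Iic a) < m.real (Set.Iic x) := by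
  have hpos : 0 < m.real (Set.Ioc a x) := by
    refine ENNReal.toReal_pos (fun h0 => ?_) (measure_ne_top _ _)
    have h1 := h h0
    rw [unif01, Measure.restrict_apply measurableSet_Ioc] at h1
    have h2 : Set.Ioc (max a 0) x ⊆ Set.Ioc a x ∩ Set.Icc 0 1 := fun y hy =>
      ⟨⟨(le_max_left _ _).trans_lt hy.1, hy.2⟩, ((le_max_right _ _).trans_lt hy.1).le,
        hy.2.trans hx.2.le⟩
    have h3 := measure_mono_null h2 h1
    rw [Real.volume_Ioc, ENNReal.ofReal_eq_zero, sub_nonpos] at h3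
    exact (max_lt hax hx.1).not_ge h3
  have hu : Set.Iic a ∪ Set.Ioc a x = Set.Iic x := Set.Iic_union_Ioc_eq_Iic hax.le
  have hd : Disjoint (Set.Iic a) (Set.Ioc a x) := by
    rw [Set.disjoint_left]; exact fun y hy hy' => hy'.1.not_ge hy
  rw [← hu, measureReal_union hd measurableSet_Ioc]
  linarith

lemma ae_measureReal_Iic_le_iff (h : m ≪ unif01) (h' : unif01 ≪ m) (a : ℝ) :
    ∀ᵐ x ∂m, m.real (Set.Iic x) ≤ m.real (Set.Iic a) ↔ x ≤ a := by
  filter_upwards [ae_mem_Ioo_of_ac_unif01 h] with x hx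
  refine ⟨fun hle => ?_, fun hle => monotone_measureReal_Iic hle⟩
  by_contra hlt
  exact (measureReal_Iic_lt h' hx (not_le.1 hlt)).not_ge hle

lemma map_measureReal_Iic (h : m ≪ unif01) (h' : unif01 ≪ m) :
    m.map (fun x => m.real (Set.Iic x)) = unif01 := by
  have hc := continuous_measureReal_Iic h
  have hfin : IsFiniteMeasure unif01 := by rw [unif01]; infer_instance
  have : IsProbabilityMeasure (m.map fun x => m.real (Set.Iic x)) :=
    Measure.isProbabilityMeasure_map hc.measurable.aemeasurable
  refine Measure.ext_of_Iic _ _ fun t => ?_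
  rw [Measure.map_apply hc.measurable measurableSet_Iic, unif01,
    Measure.restrict_apply measurableSet_Iic]
  have h01 := ae_mem_Ioo_of_ac_unif01 h
  have hF0 : m.real (Set.Iic 0) = 0 := by
    rw [measureReal_def, measure_eq_zero_iff_ae_notMem.2, ENNReal.toReal_zero]
    filter_upwards [h01] with w hw hc using hw.1.not_ge hc
  have hF1 : m.real (Set.Iic 1) = 1 := by
    rw [measureReal_def, (prob_compl_eq_zero_iff measurableSet_Iic).1, ENNReal.toReal_one]
    refine measure_eq_zero_iff_ae_notMem.2 ?_
    filter_upwards [h01] with w hw hc using hc hw.2.le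
  rcases lt_or_ge t 0 with ht | ht
  · have e1 : (fun x => m.real (Set.Iic x)) ⁻¹' Set.Iic t = ∅ := by
      ext x; simp only [Set.mem_preimage, Set.mem_Iic, Set.mem_empty_iff_false, iff_false, not_le]
      exact ht.trans_le measureReal_nonneg
    have e2 : Set.Iic t ∩ Set.Icc 0 1 = ∅ := by
      ext x; simp only [Set.mem_inter_iff, Set.mem_Iic, Set.mem_Icc, Set.mem_empty_iff_false,
        iff_false]
      rintro ⟨h1, h2, -⟩; linarith
    rw [e1, e2]; simp
  · rcases le_or_gt 1 t with ht1 | ht1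
    · have e1 : (fun x => m.real (Set.Iic x)) ⁻¹' Set.Iic t = Set.univ := by
        ext x; simp only [Set.mem_preimage, Set.mem_Iic, Set.mem_univ, iff_true]
        exact measureReal_le_one.trans ht1
      have e2 : Set.Iic t ∩ Set.Icc 0 1 = Set.Icc 0 1 :=
        Set.inter_eq_right.2 fun x hx => hx.2.trans ht1
      rw [e1, e2]; simp
    · obtain ⟨a, -, ha⟩ := intermediate_value_Icc (zero_le_one' ℝ) hc.continuousOn
        (show t ∈ Set.Icc (m.real (Set.Iic 0)) (m.real (Set.Iic 1)) by
          rw [hF0, hF1]; exact ⟨ht, ht1.le⟩)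
      have e2 : Set.Iic t ∩ Set.Icc 0 1 = Set.Icc 0 t := by
        ext x; simp only [Set.mem_inter_iff, Set.mem_Iic, Set.mem_Icc]
        exact ⟨fun h => ⟨h.2.1, h.1⟩, fun h => ⟨h.2, h.1, h.2.trans ht1.le⟩⟩
      have e3 : m ((fun x => m.real (Set.Iic x)) ⁻¹' Set.Iic t) = m (Set.Iic a) := by
        refine measure_congr ?_
        filter_upwards [ae_measureReal_Iic_le_iff h h' a] with x hx
        simp only at ha
        rw [ha] at hx
        exact propext hx
      rw [e3, e2, Real.volume_Icc, sub_zero, ← ha]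
      simp

end MarginalCDF

lemma unif01_eq_map_fst : unif01 = lebSq.map Prod.fst := by
  have : IsProbabilityMeasure unif01 := ⟨by simp [unif01]⟩
  rw [lebSq_eq_prod, Measure.map_fst_prod]
  simp

lemma unif01_eq_map_snd : unif01 = lebSq.map Prod.snd := by
  have : IsProbabilityMeasure unif01 := ⟨by simp [unif01]⟩
  rw [lebSq_eq_prod, Measure.map_snd_prod]
  simp

lemma cdfX_eq (ν : Measure Ω2) (x : ℝ) : cdfX ν x = (ν.map Prod.fst).real (Set.Iic x) := by
  rw [measureReal_def, Measure.map_apply measurable_fst measurableSet_Iic]; rfl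

lemma cdfY_eq (ν : Measure Ω2) (y : ℝ) : cdfY ν y = (ν.map Prod.snd).real (Set.Iic y) := by
  rw [measureReal_def, Measure.map_apply measurable_snd measurableSet_Iic]; rfl

lemma map_fst_ac {ν : Measure Ω2} (h : ν ≪ lebSq) : ν.map Prod.fst ≪ unif01 :=
  unif01_eq_map_fst ▸ h.map measurable_fst

lemma map_snd_ac {ν : Measure Ω2} (h : ν ≪ lebSq) : ν.map Prod.snd ≪ unif01 :=
  unif01_eq_map_snd ▸ h.map measurable_snd

lemma ac_map_fst {ν : Measure Ω2} (h : lebSq ≪ ν) : unif01 ≪ ν.map Prod.fst :=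
  unif01_eq_map_fst ▸ h.map measurable_fst

lemma ac_map_snd {ν : Measure Ω2} (h : lebSq ≪ ν) : unif01 ≪ ν.map Prod.snd :=
  unif01_eq_map_snd ▸ h.map measurable_snd

section EquivalentToLebesgue

variable {ν : Measure Ω2} [IsProbabilityMeasure ν]

instance isProbabilityMeasure_map_fst : IsProbabilityMeasure (ν.map Prod.fst) :=
  Measure.isProbabilityMeasure_map measurable_fst.aemeasurable

instance isProbabilityMeasure_map_snd : IsProbabilityMeasure (ν.map Prod.snd) :=
  Measure.isProbabilityMeasure_map measurable_snd.aemeasurable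

lemma monotone_cdfX : Monotone (cdfX ν) := fun a b h => by
  rw [cdfX_eq, cdfX_eq]; exact monotone_measureReal_Iic h

lemma monotone_cdfY : Monotone (cdfY ν) := fun a b h => by
  rw [cdfY_eq, cdfY_eq]; exact monotone_measureReal_Iic h

lemma measurable_cdf_prod : Measurable fun p : Ω2 => (cdfX ν p.1, cdfY ν p.2) :=
  (monotone_cdfX.measurable.comp measurable_fst).prodMk
    (monotone_cdfY.measurable.comp measurable_snd)

lemma map_cdfX (h : ν ≪ lebSq) (h' : lebSq ≪ ν) : (ν.map Prod.fst).map (cdfX ν) = unif01 := by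
  simp only [funext (cdfX_eq ν)]
  exact map_measureReal_Iic (map_fst_ac h) (ac_map_fst h')

lemma map_cdfY (h : ν ≪ lebSq) (h' : lebSq ≪ ν) : (ν.map Prod.snd).map (cdfY ν) = unif01 := by
  simp only [funext (cdfY_eq ν)]
  exact map_measureReal_Iic (map_snd_ac h) (ac_map_snd h')

lemma Omap_map_fst (h : ν ≪ lebSq) (h' : lebSq ≪ ν) : (Omap ν).map Prod.fst = unif01 := by
  rw [← map_cdfX h h', Omap, Measure.map_map measurable_fst measurable_cdf_prod,
    Measure.map_map monotone_cdfX.measurable measurable_fst]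
  rfl

lemma Omap_map_snd (h : ν ≪ lebSq) (h' : lebSq ≪ ν) : (Omap ν).map Prod.snd = unif01 := by
  rw [← map_cdfY h h', Omap, Measure.map_map measurable_snd measurable_cdf_prod,
    Measure.map_map monotone_cdfY.measurable measurable_snd]
  rfl

lemma Omap_unitSq : Omap ν unitSq = 1 := by
  rw [Omap, Measure.map_apply measurable_cdf_prod measurableSet_unitSq]
  have : (fun p : Ω2 => (cdfX ν p.1, cdfY ν p.2)) ⁻¹' unitSq = Set.univ := by
    ext p
    simp only [unitSq, Set.mem_preimage, Set.mem_prod, Set.mem_Icc, Set.mem_univ, iff_true]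
    rw [cdfX_eq, cdfY_eq]
    exact ⟨⟨measureReal_nonneg, measureReal_le_one⟩, measureReal_nonneg, measureReal_le_one⟩
  rw [this, measure_univ]

instance isProbabilityMeasure_Omap : IsProbabilityMeasure (Omap ν) :=
  Measure.isProbabilityMeasure_map measurable_cdf_prod.aemeasurable

lemma eq_prod_of_Omap_eq (h : ν ≪ lebSq) (h' : lebSq ≪ ν) (hO : Omap ν = lebSq) :
    (ν.map Prod.fst).prod (ν.map Prod.snd) = ν := by
  have rect : ∀ a b : ℝ, ν (Set.Iic a ×ˢ Set.Iic b)
      = ν.map Prod.fst (Set.Iic a) * ν.map Prod.snd (Set.Iic b) := by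
    intro a b
    have hx : ∀ᵐ p ∂ν, cdfX ν p.1 ≤ cdfX ν a ↔ p.1 ≤ a := by
      simp only [cdfX_eq]
      exact ae_of_ae_map measurable_fst.aemeasurable
        (ae_measureReal_Iic_le_iff (map_fst_ac h) (ac_map_fst h') a)
    have hy : ∀ᵐ p ∂ν, cdfY ν p.2 ≤ cdfY ν b ↔ p.2 ≤ b := by
      simp only [cdfY_eq]
      exact ae_of_ae_map measurable_snd.aemeasurable
        (ae_measureReal_Iic_le_iff (map_snd_ac h) (ac_map_snd h') b)
    have h1 : ν (Set.Iic a ×ˢ Set.Iic b)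
        = ν ((fun p : Ω2 => (cdfX ν p.1, cdfY ν p.2)) ⁻¹'
          (Set.Iic (cdfX ν a) ×ˢ Set.Iic (cdfY ν b))) := by
      refine measure_congr ?_
      filter_upwards [hx, hy] with p h1 h2
      exact propext (and_congr h1.symm h2.symm)
    rw [h1, ← Measure.map_apply measurable_cdf_prod (measurableSet_Iic.prod measurableSet_Iic)]
    change Omap ν _ = _
    have hu : ∀ t : ℝ, 0 ≤ t → t ≤ 1 → unif01 (Set.Iic t) = ENNReal.ofReal t := by
      intro t h0 h1
      have e2 : Set.Iic t ∩ Set.Icc 0 1 = Set.Icc 0 t := by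
        ext x; simp only [Set.mem_inter_iff, Set.mem_Iic, Set.mem_Icc]
        exact ⟨fun h => ⟨h.2.1, h.1⟩, fun h => ⟨h.2, h.1, h.2.trans h1⟩⟩
      rw [unif01, Measure.restrict_apply measurableSet_Iic, e2, Real.volume_Icc, sub_zero]
    have : IsFiniteMeasure unif01 := by rw [unif01]; infer_instance
    rw [hO, lebSq_eq_prod, Measure.prod_prod, cdfX_eq, cdfY_eq,
      hu _ measureReal_nonneg measureReal_le_one, hu _ measureReal_nonneg measureReal_le_one]
    simp
  have gen :
      MeasurableSpace.generateFrom (Set.range Set.Iic) = (inferInstance : MeasurableSpace ℝ) :=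
    (borel_eq_generateFrom_Iic ℝ).symm.trans (BorelSpace.measurable_eq (α := ℝ)).symm
  have span : ∀ m : Measure ℝ, IsProbabilityMeasure m →
      m.FiniteSpanningSetsIn (Set.range Set.Iic) := fun m _ =>
    ⟨fun n => Set.Iic (n : ℝ), fun n => ⟨n, rfl⟩, fun n => measure_lt_top _ _,
      Set.eq_univ_of_forall fun x => Set.mem_iUnion.2 (exists_nat_ge x)⟩
  refine Measure.prod_eq_generateFrom gen gen isPiSystem_Iic isPiSystem_Iic
    (span _ inferInstance) (span _ inferInstance) ?_
  rintro _ ⟨a, rfl⟩ _ ⟨b, rfl⟩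
  exact rect a b

end EquivalentToLebesgue

/-- If a product measure on the square has a continuous density, then the density factorizes. -/
lemma exists_mul_of_prod {u : Ω2 → ℝ} (hu : Continuous u) (u0 : ∀ z, 0 ≤ u z) {ν : Measure Ω2}
    (hν : ν = lebSq.withDensity fun z => ENNReal.ofReal (u z))
    (hp : (ν.map Prod.fst).prod (ν.map Prod.snd) = ν) :
    ∃ a b : ℝ → ℝ, ∀ z ∈ unitSq, u z = a z.1 * b z.2 := by
  have hfin : IsFiniteMeasure unif01 := by rw [unif01]; infer_instance
  set a : ℝ → ℝ := fun x => ∫ y in Set.Icc (0 : ℝ) 1, u (x, y) with ha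
  set b : ℝ → ℝ := fun y => ∫ x in Set.Icc (0 : ℝ) 1, u (x, y) with hb
  have ac : Continuous a :=
    continuous_parametric_integral_of_continuous (f := fun x y => u (x, y))
      (hu.comp continuous_id) isCompact_Icc
  have bc : Continuous b :=
    continuous_parametric_integral_of_continuous (f := fun y x => u (x, y))
      (hu.comp continuous_swap) isCompact_Icc
  have a0 : ∀ x, 0 ≤ a x := fun x => integral_nonneg fun y => u0 _
  have b0 : ∀ x, 0 ≤ b x := fun x => integral_nonneg fun y => u0 _
  have um : Measurable fun z => ENNReal.ofReal (u z) := hu.measurable.ennreal_ofReal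
  have ea : ∀ x, ∫⁻ y, ENNReal.ofReal (u (x, y)) ∂unif01 = ENNReal.ofReal (a x) := fun x => by
    rw [ha, ofReal_integral_eq_lintegral_ofReal _ (ae_of_all _ fun y => u0 _)]
    · rfl
    · exact (hu.comp (by fun_prop : Continuous fun y => (x, y))).continuousOn.integrableOn_compact
        isCompact_Icc
  have eb : ∀ y, ∫⁻ x, ENNReal.ofReal (u (x, y)) ∂unif01 = ENNReal.ofReal (b y) := fun y => by
    rw [hb, ofReal_integral_eq_lintegral_ofReal _ (ae_of_all _ fun x => u0 _)]
    · rfl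
    · exact (hu.comp (by fun_prop : Continuous fun x => (x, y))).continuousOn.integrableOn_compact
        isCompact_Icc
  have h1 : ν.map Prod.fst = unif01.withDensity fun x => ENNReal.ofReal (a x) := by
    refine Measure.ext fun s hs => ?_
    rw [Measure.map_apply measurable_fst hs, withDensity_apply _ hs, hν,
      withDensity_apply _ (measurable_fst hs), ← Set.prod_univ, lebSq_eq_prod,
      ← Measure.prod_restrict, Measure.restrict_univ, lintegral_prod _ um.aemeasurable]
    simp only [ea]
  have h2 : ν.map Prod.snd = unif01.withDensity fun y => ENNReal.ofReal (b y) := by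
    refine Measure.ext fun s hs => ?_
    rw [Measure.map_apply measurable_snd hs, withDensity_apply _ hs, hν,
      withDensity_apply _ (measurable_snd hs), ← Set.univ_prod, lebSq_eq_prod,
      ← Measure.prod_restrict, Measure.restrict_univ, lintegral_prod_symm _ um.aemeasurable]
    simp only [eb]
  have h3 : lebSq.withDensity (fun z => ENNReal.ofReal (a z.1) * ENNReal.ofReal (b z.2))
      = lebSq.withDensity fun z => ENNReal.ofReal (u z) := by
    rw [← hν, ← hp, h1, h2, prod_withDensity ac.measurable.ennreal_ofReal
      bc.measurable.ennreal_ofReal, ← lebSq_eq_prod]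
  have abm : Measurable fun z : Ω2 => ENNReal.ofReal (a z.1) * ENNReal.ofReal (b z.2) :=
    (ac.measurable.comp measurable_fst).ennreal_ofReal.mul
      (bc.measurable.comp measurable_snd).ennreal_ofReal
  rw [withDensity_eq_iff_of_sigmaFinite abm.aemeasurable um.aemeasurable] at h3
  have h4 : u =ᵐ[lebSq] fun z => a z.1 * b z.2 := by
    filter_upwards [h3] with z hz
    rw [← ENNReal.ofReal_mul (a0 _)] at hz
    exact ((ENNReal.ofReal_eq_ofReal_iff (mul_nonneg (a0 _) (b0 _)) (u0 _)).1 hz).symm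
  exact ⟨a, b, Measure.eqOn_of_ae_eq h4 hu.continuousOn
    ((ac.comp continuous_fst).mul (bc.comp continuous_snd)).continuousOn
    unitSq_subset_closure_interior⟩

section Balanced

variable {νθ ν' : Measure Ω2} [IsProbabilityMeasure νθ] [IsProbabilityMeasure ν'] {θ η : ℝ}

lemma measurable_field : Measurable fun z => 2 * θ * invPot νθ z + -2 * η * invPot ν' z :=
  ((measurable_invPot νθ).const_mul _).add ((measurable_invPot ν').const_mul _)

lemma abs_two_field_le (z : Ω2) :
    |2 * θ * invPot νθ z + -2 * η * invPot ν' z| ≤ |2 * θ| + |-2 * η| :=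
  abs_field_le (g := fun z => 2 * θ * invPot νθ z) (fun z => by
    rw [abs_mul, abs_of_nonneg (invPot_nonneg _ _)]
    exact mul_le_of_le_one_right (abs_nonneg _) (invPot_le_one _ _))
    (invPot_nonneg ν') (invPot_le_one ν') z

lemma IsSelfTilt.lebSq_ac (h : IsSelfTilt (fun z => 2 * θ * invPot νθ z) (-2 * η) ν') :
    lebSq ≪ ν' := by
  unfold IsSelfTilt at h
  conv_rhs => rw [h]
  exact absolutelyContinuous_tilted
    (integrable_exp_of_abs_le measurable_field abs_two_field_le)

lemma IsSelfTilt.eq_tilted_invPot (hθ : IsSelfTilt (fun _ => 0) (2 * θ) νθ)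
    (h : IsSelfTilt (fun z => 2 * θ * invPot νθ z) (-2 * η) ν') :
    νθ = ν'.tilted fun z => 2 * η * invPot ν' z := by
  have e : (fun z => 2 * θ * invPot νθ z + -2 * η * invPot ν' z) + (fun z => 2 * η * invPot ν' z)
      = fun z => 2 * θ * invPot νθ z := by
    ext z; simp only [Pi.add_apply]; ring
  have h2 := tilted_tilted (integrable_exp_of_abs_le (μ := lebSq)
    (measurable_field (νθ := νθ) (ν' := ν') (θ := θ) (η := η))
    abs_two_field_le) (fun z => 2 * η * invPot ν' z)
  rw [e, ← hθ.eq_tilted] at h2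
  unfold IsSelfTilt at h
  rw [← h] at h2
  exact h2.symm

/-- The balanced tilt is not pushed to Lebesgue measure by its marginal distribution functions. -/
lemma IsSelfTilt.Omap_ne_lebSq (hac : νθ ≪ lebSq) (hθ0 : 0 < θ)
    (h : IsSelfTilt (fun z => 2 * θ * invPot νθ z) (-2 * η) ν')
    (ht : 1 / 2 < tPat inv2 νθ) (ht' : tPat inv2 ν' = 1 / 2) : Omap ν' ≠ lebSq := by
  intro hO
  have hp := eq_prod_of_Omap_eq h.ac h.lebSq_ac hO
  set G : Ω2 → ℝ := fun z => 2 * θ * invPot νθ z + -2 * η * invPot ν' z with hG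
  have hGc : Continuous G := ((continuous_invPot_of_ac hac).const_mul _).add
    ((continuous_invPot_of_ac h.ac).const_mul _)
  have hZ : 0 < ∫ z, Real.exp (G z) ∂lebSq := integral_exp_pos
    (integrable_exp_of_abs_le measurable_field abs_two_field_le)
  obtain ⟨a, b, hab⟩ := exists_mul_of_prod
    (u := fun z => Real.exp (G z) / ∫ z, Real.exp (G z) ∂lebSq)
    (hGc.rexp.div_const _) (fun z => (div_pos (Real.exp_pos _) hZ).le) h hp
  have cross : ∀ x ∈ Set.Icc (0 : ℝ) 1, ∀ y ∈ Set.Icc (0 : ℝ) 1,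
      G (0, 0) + G (x, y) = G (0, y) + G (x, 0) := by
    intro x hx y hy
    have m0 : (0 : ℝ) ∈ Set.Icc (0 : ℝ) 1 := by simp
    have e1 := hab (0, 0) ⟨m0, m0⟩
    have e2 := hab (x, y) ⟨hx, hy⟩
    have e3 := hab (0, y) ⟨m0, hy⟩
    have e4 := hab (x, 0) ⟨hx, m0⟩
    rw [div_eq_iff hZ.ne'] at e1 e2 e3 e4
    rw [← Real.exp_eq_exp, Real.exp_add (G _), Real.exp_add (G _), e1, e2, e3, e4]
    ring
  have rect : ∀ x ∈ Set.Icc (0 : ℝ) 1, ∀ y ∈ Set.Icc (0 : ℝ) 1,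
      θ * νθ.real (Set.Iio x ×ˢ Set.Iio y) = η * ν'.real (Set.Iio x ×ˢ Set.Iio y) := by
    intro x hx y hy
    have := cross x hx y hy
    simp only [hG, invPot_eq_rect hac, invPot_eq_rect h.ac, measureReal_rect_zero_left hac,
      measureReal_rect_zero_right hac, measureReal_rect_zero_left h.ac,
      measureReal_rect_zero_right h.ac] at this
    linarith
  have m1 : (1 : ℝ) ∈ Set.Icc (0 : ℝ) 1 := by simp
  have hθη : θ = η := by
    simpa [measureReal_rect_one hac, measureReal_rect_one h.ac] using rect 1 m1 1 m1
  have hr : ∀ x ∈ Set.Icc (0 : ℝ) 1, ∀ y ∈ Set.Icc (0 : ℝ) 1,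
      νθ.real (Set.Iio x ×ˢ Set.Iio y) = ν'.real (Set.Iio x ×ˢ Set.Iio y) := by
    intro x hx y hy
    have := rect x hx y hy
    rw [← hθη] at this
    exact mul_left_cancel₀ hθ0.ne' this
  have hV : ∀ z ∈ unitSq, invPot νθ z = invPot ν' z := by
    rintro ⟨x, y⟩ ⟨hx, hy⟩
    rw [invPot_eq_rect hac, invPot_eq_rect h.ac, hr 1 m1 y hy, hr x hx 1 m1, hr x hx y hy]
  have hE : ∀ μ : Measure Ω2, μ ≪ lebSq → ∫ z, invPot νθ z ∂μ = ∫ z, invPot ν' z ∂μ := by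
    intro μ hμ
    have hm : ∀ᵐ w ∂μ, w ∈ unitSq := hμ.ae_le (ae_restrict_mem measurableSet_unitSq)
    exact integral_congr_ae (hm.mono hV)
  have h1 := hE νθ hac
  rw [integral_invPot_comm ν' νθ, hE ν' h.ac, ← tPat_inv2, ← tPat_inv2] at h1
  linarith

end Balanced

/-- The empirical measure of a sample. -/
def empM {n : ℕ} (z : Fin n → Ω2) : Measure Ω2 :=
  (n : ℝ≥0∞)⁻¹ • ∑ i : Fin n, Measure.dirac (z i)

section Empirical

variable {n : ℕ}

lemma isProbabilityMeasure_empM (hn : n ≠ 0) (z : Fin n → Ω2) :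
    IsProbabilityMeasure (empM z) := by
  refine ⟨?_⟩
  have h1 : (n : ℝ≥0∞) ≠ 0 := by exact_mod_cast hn
  simp only [empM, Measure.smul_apply, Measure.finsetSum_apply, measure_univ,
    Finset.sum_const, Finset.card_univ, Fintype.card_fin, nsmul_eq_mul, mul_one, smul_eq_mul]
  exact ENNReal.inv_mul_cancel h1 (ENNReal.natCast_ne_top n)

lemma integral_empM (z : Fin n → Ω2) (f : Ω2 → ℝ) :
    ∫ w, f w ∂empM z = (∑ i, f (z i)) / n := by
  rw [empM, integral_smul_measure, integral_finsetSum_measure fun i _ => integrable_dirac (by simp)]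
  simp only [integral_dirac, ENNReal.toReal_inv, ENNReal.toReal_natCast, smul_eq_mul]
  ring

lemma measureReal_empM (z : Fin n → Ω2) {A : Set Ω2} (hA : MeasurableSet A) :
    (empM z).real A = (∑ i, A.indicator 1 (z i)) / n := by
  rw [← integral_indicator_one hA, integral_empM]

lemma map_empM (z : Fin n → Ω2) {F : Ω2 → Ω2} (hF : Measurable F) :
    (empM z).map F = empM fun i => F (z i) := by
  rw [empM, Measure.map_smul, Measure.map_finset_sum' hF.aemeasurable]
  simp only [Measure.map_dirac' hF]
  rfl

lemma exists_hPat_eq_one {z : Fin n → Ω2} (hx : Function.Injective fun i => (z i).1)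
    (hy : Function.Injective fun i => (z i).2) : ∃ σ : Equiv.Perm (Fin n), hPat σ z = 1 := by
  refine ⟨(Tuple.sort fun i => (z i).2)⁻¹ * Tuple.sort fun i => (z i).1, ?_⟩
  unfold hPat
  rw [if_pos]
  refine ⟨Tuple.sort fun i => (z i).1, ?_, ?_⟩
  · exact (Tuple.monotone_sort fun i => (z i).1).strictMono_of_injective
      (hx.comp (Equiv.injective _))
  · simpa [Function.comp_def] using (Tuple.monotone_sort fun i => (z i).2).strictMono_of_injective
      (hy.comp (Equiv.injective _))

lemma inducedPerm_spec {z : Fin n → Ω2} (hx : Function.Injective fun i => (z i).1)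
    (hy : Function.Injective fun i => (z i).2) : ∃ τ : Equiv.Perm (Fin n),
      StrictMono (fun i => (z (τ i)).1) ∧
      StrictMono (fun i => (z (τ ((inducedPerm z)⁻¹ i))).2) := by
  have h := exists_hPat_eq_one hx hy
  have h2 : hPat (inducedPerm z) z = 1 := by
    rw [inducedPerm, dif_pos h]; exact h.choose_spec
  by_contra hc
  rw [hPat, if_neg hc] at h2
  exact zero_ne_one h2

lemma card_filter_le_strictMono {f : Fin n → ℝ} {ρ : Equiv.Perm (Fin n)}
    (h : StrictMono fun i => f (ρ i)) (i : Fin n) :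
    ∑ j, (if f j ≤ f (ρ i) then (1 : ℝ) else 0) = (i : ℕ) + 1 := by
  rw [← Equiv.sum_comp ρ]
  have : ∀ j, (f (ρ j) ≤ f (ρ i)) ↔ j ≤ i := fun j => h.le_iff_le
  simp only [this]
  rw [Finset.sum_boole, Finset.filter_ge_eq_Iic, Fin.card_Iic]
  push_cast; ring

lemma cdfX_empM {z : Fin n → Ω2} {ρ : Equiv.Perm (Fin n)}
    (h : StrictMono fun i => (z (ρ i)).1) (i : Fin n) :
    cdfX (empM z) (z (ρ i)).1 = ((i : ℕ) + 1 : ℝ) / n := by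
  have := measureReal_empM z (A := {p : Ω2 | p.1 ≤ (z (ρ i)).1})
    (measurable_fst measurableSet_Iic)
  rw [cdfX, ← measureReal_def, this, ← card_filter_le_strictMono (f := fun i => (z i).1) h i]
  simp [Set.indicator_apply]

lemma cdfY_empM {z : Fin n → Ω2} {ρ : Equiv.Perm (Fin n)}
    (h : StrictMono fun i => (z (ρ i)).2) (i : Fin n) :
    cdfY (empM z) (z (ρ i)).2 = ((i : ℕ) + 1 : ℝ) / n := by
  have := measureReal_empM z (A := {p : Ω2 | p.2 ≤ (z (ρ i)).2})
    (measurable_snd measurableSet_Iic)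
  rw [cdfY, ← measureReal_def, this, ← card_filter_le_strictMono (f := fun i => (z i).2) h i]
  simp [Set.indicator_apply]

lemma EmM_inducedPerm (hn : n ≠ 0) {z : Fin n → Ω2} (hx : Function.Injective fun i => (z i).1)
    (hy : Function.Injective fun i => (z i).2) : EmM (inducedPerm z) = Omap (empM z) := by
  have := isProbabilityMeasure_empM hn z
  obtain ⟨τ, h1, h2⟩ := inducedPerm_spec hx hy
  rw [Omap, map_empM z measurable_cdf_prod, empM, EmM]
  congr 1
  rw [← Equiv.sum_comp τ fun i => Measure.dirac (cdfX (empM z) (z i).1, cdfY (empM z) (z i).2)]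
  refine Finset.sum_congr rfl fun i _ => ?_
  rw [cdfX_empM h1]
  have h3 := cdfY_empM (ρ := τ * (inducedPerm z)⁻¹) h2 (inducedPerm z i)
  simp only [Equiv.Perm.mul_apply, Equiv.Perm.inv_def, Equiv.symm_apply_apply] at h3
  rw [← h3]

lemma invKer_eq_ite (z w : Ω2) : invKer z w
    = if (w.1 < z.1 ∧ z.2 < w.2) ∨ (z.1 < w.1 ∧ w.2 < z.2) then 1 else 0 := by
  simp only [invKer, mul_neg_iff, sub_pos, sub_neg]

lemma tPerm_inducedPerm (hn : n ≠ 0) {z : Fin n → Ω2}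
    (hx : Function.Injective fun i => (z i).1) (hy : Function.Injective fun i => (z i).2) :
    tPerm inv2 (inducedPerm z) = tPat inv2 (empM z) := by
  have hp := isProbabilityMeasure_empM hn z
  have hn0 : (0 : ℝ) < n := by positivity
  obtain ⟨τ, h1, h2⟩ := inducedPerm_spec hx hy
  have key : ∀ ρ : Equiv.Perm (Fin n), ∀ f : Fin n → ℝ, ∀ F : ℝ → ℝ,
      (StrictMono fun i => f (ρ i)) → (∀ i, F (f (ρ i)) = ((i : ℕ) + 1 : ℝ) / n) →
      ∀ i j, F (f i) < F (f j) ↔ f i < f j := by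
    intro ρ f F hm hF i j
    obtain ⟨a, rfl⟩ := ρ.surjective i
    obtain ⟨b, rfl⟩ := ρ.surjective j
    rw [hF, hF, hm.lt_iff_lt (a := a) (b := b), div_lt_div_iff_of_pos_right hn0]
    simp
  have kx := key τ (fun i => (z i).1) (cdfX (empM z)) h1 (cdfX_empM h1)
  have ky := key (τ * (inducedPerm z)⁻¹) (fun i => (z i).2) (cdfY (empM z)) h2 (cdfY_empM h2)
  rw [tPerm, EmM_inducedPerm hn hx hy, tPat_inv2, tPat_inv2, Omap,
    map_empM z measurable_cdf_prod]
  simp only [invPot, integral_empM, invKer_eq_ite, kx, ky]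

end Empirical

lemma measurePreserving_pair {μ : Measure Ω2} [IsProbabilityMeasure μ] {n : ℕ} {i j : Fin n}
    (hij : i ≠ j) : MeasurePreserving (fun z : Fin n → Ω2 => (z i, z j)) (pmeas μ n)
      (μ.prod μ) := by
  have hind := (ProbabilityTheory.iIndepFun_pi (μ := fun _ : Fin n => μ)
    (X := fun _ => id) (fun _ => aemeasurable_id)).indepFun hij
  have hi : Measurable fun z : Fin n → Ω2 => id (z i) := measurable_pi_apply i
  have hj : Measurable fun z : Fin n → Ω2 => id (z j) := measurable_pi_apply j
  rw [ProbabilityTheory.indepFun_iff_map_prod_eq_prod_map_map hi.aemeasurable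
    hj.aemeasurable] at hind
  refine ⟨(measurable_pi_apply i).prodMk (measurable_pi_apply j), hind.trans ?_⟩
  congr 1
  · exact (measurePreserving_eval (fun _ : Fin n => μ) i).map_eq
  · exact (measurePreserving_eval (fun _ : Fin n => μ) j).map_eq

lemma ae_injective_of_forall_eq_null {μ : Measure Ω2} [IsProbabilityMeasure μ] {p : Ω2 → ℝ}
    (hp : Measurable p) (h : ∀ x, μ {w | p w = x} = 0) (n : ℕ) :
    ∀ᵐ z ∂pmeas μ n, Function.Injective fun i => p (z i) := by
  have hpair : ∀ᵐ w ∂μ.prod μ, p w.1 ≠ p w.2 := by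
    have hm : MeasurableSet {w : Ω2 × Ω2 | p w.1 ≠ p w.2} :=
      (measurableSet_eq_fun (hp.comp measurable_fst) (hp.comp measurable_snd)).compl
    refine (Measure.ae_prod_mem_iff_ae_ae_mem hm).2 (ae_of_all _ fun x => ?_)
    have := measure_eq_zero_iff_ae_notMem.1 (h (p x))
    filter_upwards [this] with y hy hxy using hy hxy.symm
  have h2 : ∀ᵐ z ∂pmeas μ n, ∀ i j : Fin n, i ≠ j → p (z i) ≠ p (z j) := by
    simp only [ae_all_iff]
    exact fun i j hij => (measurePreserving_pair hij).quasiMeasurePreserving.ae hpair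
  filter_upwards [h2] with z hz i j hij
  by_contra hne
  exact hz i j hne hij

section Grid

variable {M : ℕ}

/-- The inversion kernel on a grid of cells. -/
def gridKer (c d : Fin M × Fin M) : ℝ :=
  if (d.1 < c.1 ∧ c.2 < d.2) ∨ (c.1 < d.1 ∧ d.2 < c.2) then 1 else 0

lemma gridKer_nonneg (c d : Fin M × Fin M) : 0 ≤ gridKer c d := by
  unfold gridKer; split_ifs <;> norm_num

lemma gridKer_le_one (c d : Fin M × Fin M) : gridKer c d ≤ 1 := by
  unfold gridKer; split_ifs <;> norm_num

lemma gridKer_comm (c d : Fin M × Fin M) : gridKer c d = gridKer d c := by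
  unfold gridKer; congr 1; rw [or_comm]

variable {a b : ℝ → Fin M}

lemma gridKer_le_invKer (ha : Monotone a) (hb : Monotone b) (z w : Ω2) :
    gridKer (a z.1, b z.2) (a w.1, b w.2) ≤ invKer z w := by
  rw [invKer_eq_ite, gridKer]
  split_ifs with h1 h2 h2
  · exact le_rfl
  · exact absurd (h1.imp (fun h => ⟨ha.reflect_lt h.1, hb.reflect_lt h.2⟩)
      fun h => ⟨ha.reflect_lt h.1, hb.reflect_lt h.2⟩) h2
  · exact zero_le_one
  · exact le_rfl

lemma invKer_le_gridKer (ha : Monotone a) (hb : Monotone b) (z w : Ω2) :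
    invKer z w ≤ gridKer (a z.1, b z.2) (a w.1, b w.2)
      + (if a w.1 = a z.1 then 1 else 0) + (if b w.2 = b z.2 then 1 else 0) := by
  have h0 := gridKer_nonneg (a z.1, b z.2) (a w.1, b w.2)
  by_cases h1 : a w.1 = a z.1
  · have := invKer_le_one z w
    rw [if_pos h1]; split_ifs <;> linarith
  by_cases h2 : b w.2 = b z.2
  · have := invKer_le_one z w
    rw [if_neg h1, if_pos h2]; linarith
  rw [if_neg h1, if_neg h2, add_zero, add_zero, invKer_eq_ite]
  split_ifs with h3
  · rw [gridKer, if_pos]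
    exact h3.imp (fun h => ⟨(ha h.1.le).lt_of_ne h1, (hb h.2.le).lt_of_ne' h2⟩)
      fun h => ⟨(ha h.1.le).lt_of_ne' h1, (hb h.2.le).lt_of_ne h2⟩
  · exact h0

lemma measurable_cell (ha : Monotone a) (hb : Monotone b) :
    Measurable fun z : Ω2 => (a z.1, b z.2) :=
  (ha.measurable.comp measurable_fst).prodMk (hb.measurable.comp measurable_snd)

lemma integral_gridKer (ha : Monotone a) (hb : Monotone b) (μ ν : Measure Ω2)
    [IsProbabilityMeasure μ] [IsProbabilityMeasure ν] :
    ∫ z, ∫ w, gridKer (a z.1, b z.2) (a w.1, b w.2) ∂μ ∂ν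
      = ∑ c, ∑ d, (ν.map fun z => (a z.1, b z.2)).real {c}
          * ((μ.map fun z => (a z.1, b z.2)).real {d} * gridKer c d) := by
  have hm := measurable_cell ha hb
  have : IsProbabilityMeasure (μ.map fun z : Ω2 => (a z.1, b z.2)) :=
    Measure.isProbabilityMeasure_map hm.aemeasurable
  have : IsProbabilityMeasure (ν.map fun z : Ω2 => (a z.1, b z.2)) :=
    Measure.isProbabilityMeasure_map hm.aemeasurable
  have h (c : Fin M × Fin M) : ∫ w : Ω2, gridKer c (a w.1, b w.2) ∂μ
      = ∑ d, (μ.map fun z => (a z.1, b z.2)).real {d} * gridKer c d := by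
    rw [← integral_map (f := gridKer c) hm.aemeasurable
      (Measurable.of_discrete).aestronglyMeasurable, integral_fintype .of_finite]
    rfl
  simp only [h]
  rw [← integral_map (μ := ν) (φ := fun z : Ω2 => (a z.1, b z.2)) (f := fun c => ∑ d,
    (μ.map fun z => (a z.1, b z.2)).real {d} * gridKer c d) hm.aemeasurable
      (Measurable.of_discrete).aestronglyMeasurable, integral_fintype .of_finite]
  simp only [smul_eq_mul, Finset.mul_sum]

lemma integral_gridKer_le (ha : Monotone a) (hb : Monotone b) (μ : Measure Ω2)
    [IsProbabilityMeasure μ] :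
    ∫ z, ∫ w, gridKer (a z.1, b z.2) (a w.1, b w.2) ∂μ ∂μ ≤ tPat inv2 μ := by
  have hm := measurable_cell ha hb
  rw [tPat_inv2]
  have hk : Measurable fun p : Ω2 × Ω2 => gridKer (a p.1.1, b p.1.2) (a p.2.1, b p.2.2) :=
    (Measurable.of_discrete (f := fun p : (Fin M × Fin M) × (Fin M × Fin M) =>
      gridKer p.1 p.2)).comp ((hm.comp measurable_fst).prodMk (hm.comp measurable_snd))
  have hi (z : Ω2) : Integrable (fun w : Ω2 => gridKer (a z.1, b z.2) (a w.1, b w.2)) μ :=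
    .of_bound (hk.comp measurable_prodMk_left).aestronglyMeasurable 1 (ae_of_all _ fun w => by
      rw [Real.norm_of_nonneg (gridKer_nonneg _ _)]; exact gridKer_le_one _ _)
  have hp (z : Ω2) : ∫ w, gridKer (a z.1, b z.2) (a w.1, b w.2) ∂μ ≤ invPot μ z :=
    integral_mono (hi z) (integrable_invKer_right μ z) fun w => gridKer_le_invKer ha hb z w
  refine integral_mono_of_nonneg (ae_of_all _ fun z => integral_nonneg fun w =>
    gridKer_nonneg _ _) (integrable_invPot μ μ) (ae_of_all _ hp)

lemma integral_invPot_le (ha : Monotone a) (hb : Monotone b) (L ν : Measure Ω2)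
    [IsProbabilityMeasure L] [IsProbabilityMeasure ν] {κ : ℝ}
    (hκa : ∀ i, ν.real {z | a z.1 = i} ≤ κ) (hκb : ∀ i, ν.real {z | b z.2 = i} ≤ κ) :
    ∫ z, invPot ν z ∂L ≤ ∫ z, ∫ w, gridKer (a z.1, b z.2) (a w.1, b w.2) ∂ν ∂L + 2 * κ := by
  have hm := measurable_cell ha hb
  have hk : Measurable fun p : Ω2 × Ω2 => gridKer (a p.1.1, b p.1.2) (a p.2.1, b p.2.2) :=
    (Measurable.of_discrete (f := fun p : (Fin M × Fin M) × (Fin M × Fin M) =>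
      gridKer p.1 p.2)).comp ((hm.comp measurable_fst).prodMk (hm.comp measurable_snd))
  have hi (z : Ω2) : Integrable (fun w : Ω2 => gridKer (a z.1, b z.2) (a w.1, b w.2)) ν :=
    .of_bound (hk.comp measurable_prodMk_left).aestronglyMeasurable 1 (ae_of_all _ fun w => by
      rw [Real.norm_of_nonneg (gridKer_nonneg _ _)]; exact gridKer_le_one _ _)
  have hsa (i) : MeasurableSet {z : Ω2 | a z.1 = i} :=
    (ha.measurable.comp measurable_fst) (measurableSet_singleton i)
  have hsb (i) : MeasurableSet {z : Ω2 | b z.2 = i} :=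
    (hb.measurable.comp measurable_snd) (measurableSet_singleton i)
  have hp (z : Ω2) : invPot ν z
      ≤ ∫ w, gridKer (a z.1, b z.2) (a w.1, b w.2) ∂ν + 2 * κ := by
    have ia : Integrable ({w : Ω2 | a w.1 = a z.1}.indicator (1 : Ω2 → ℝ)) ν :=
      (integrable_const (1 : ℝ)).indicator (hsa _)
    have ib : Integrable ({w : Ω2 | b w.2 = b z.2}.indicator (1 : Ω2 → ℝ)) ν :=
      (integrable_const (1 : ℝ)).indicator (hsb _)
    have h1 := integral_mono (integrable_invKer_right ν z) (((hi z).add ia).add ib) fun w =>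
      (invKer_le_gridKer ha hb z w).trans_eq (by simp [Set.indicator_apply])
    rw [integral_add' ((hi z).add ia) ib, integral_add' (hi z) ia,
      integral_indicator_one (hsa _), integral_indicator_one (hsb _)] at h1
    have := hκa (a z.1)
    have := hκb (b z.2)
    unfold invPot
    linarith
  have ig : Integrable (fun z : Ω2 => ∫ w, gridKer (a z.1, b z.2) (a w.1, b w.2) ∂ν) L := by
    refine .of_bound (hk.stronglyMeasurable.integral_prod_right (ν := ν)).aestronglyMeasurable 1
      (ae_of_all _ fun z => ?_)
    rw [Real.norm_of_nonneg (integral_nonneg fun w => gridKer_nonneg _ _)]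
    simpa using integral_mono (hi z) (integrable_const (1 : ℝ)) fun w => gridKer_le_one _ _
  have := integral_mono (integrable_invPot ν L) (ig.add (integrable_const (2 * κ))) hp
  simpa [integral_add ig (integrable_const _)] using this

/-- The interaction energy of `L` against `ν` is controlled by the self-energies of `L` and `ν`
and by the discrepancy of the two measures on unions of cells. -/
lemma two_mul_integral_invPot_le (ha : Monotone a) (hb : Monotone b) (L ν : Measure Ω2)
    [IsProbabilityMeasure L] [IsProbabilityMeasure ν] {κ r : ℝ}
    (hκa : ∀ i, ν.real {z | a z.1 = i} ≤ κ) (hκb : ∀ i, ν.real {z | b z.2 = i} ≤ κ)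
    (hr : ∀ A : Set (Fin M × Fin M), |L.real {z | (a z.1, b z.2) ∈ A}
      - ν.real {z | (a z.1, b z.2) ∈ A}| ≤ r) :
    2 * ∫ z, invPot ν z ∂L ≤ tPat inv2 L + tPat inv2 ν + 4 * r ^ 2 + 4 * κ := by
  have hm := measurable_cell ha hb
  set p : Measure (Fin M × Fin M) := L.map fun z => (a z.1, b z.2) with hp
  set q : Measure (Fin M × Fin M) := ν.map fun z => (a z.1, b z.2) with hq
  have : IsProbabilityMeasure p := Measure.isProbabilityMeasure_map hm.aemeasurable
  have : IsProbabilityMeasure q := Measure.isProbabilityMeasure_map hm.aemeasurable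
  have hr' (A : Set (Fin M × Fin M)) : |p.real A - q.real A| ≤ r := by
    rw [hp, hq, map_measureReal_apply hm A.toFinite.measurableSet,
      map_measureReal_apply hm A.toFinite.measurableSet]
    exact hr A
  have h1 := integral_gridKer_le ha hb L
  have h2 := integral_gridKer_le ha hb ν
  have h3 := integral_invPot_le ha hb L ν hκa hκb
  rw [integral_gridKer ha hb, ← hp] at h1
  rw [integral_gridKer ha hb, ← hq] at h2
  rw [integral_gridKer ha hb, ← hp, ← hq] at h3
  have hsum : ∑ c, |p.real {c} - q.real {c}| ≤ 2 * r := by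
    rw [← Finset.sum_filter_add_sum_filter_not Finset.univ fun c => q.real {c} ≤ p.real {c}]
    have e1 := hr' ↑(Finset.univ.filter fun c => q.real {c} ≤ p.real {c})
    have e2 := hr' ↑(Finset.univ.filter fun c => ¬ q.real {c} ≤ p.real {c})
    rw [← sum_measureReal_singleton, ← sum_measureReal_singleton, ← Finset.sum_sub_distrib] at e1 e2
    have e1' := le_abs_self (∑ c with q.real {c} ≤ p.real {c}, (p.real {c} - q.real {c}))
    have e2' := neg_le_abs (∑ c with ¬ q.real {c} ≤ p.real {c}, (p.real {c} - q.real {c}))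
    have e3 : ∑ c with q.real {c} ≤ p.real {c}, |p.real {c} - q.real {c}|
        = ∑ c with q.real {c} ≤ p.real {c}, (p.real {c} - q.real {c}) :=
      Finset.sum_congr rfl fun c hc => abs_of_nonneg (by
        have := (Finset.mem_filter.1 hc).2; linarith)
    have e4 : ∑ c with ¬ q.real {c} ≤ p.real {c}, |p.real {c} - q.real {c}|
        = - ∑ c with ¬ q.real {c} ≤ p.real {c}, (p.real {c} - q.real {c}) := by
      rw [← Finset.sum_neg_distrib]
      exact Finset.sum_congr rfl fun c hc => abs_of_nonpos (by
        have := (Finset.mem_filter.1 hc).2; linarith)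
    rw [e3, e4]
    linarith
  have hquad : -(∑ c, |p.real {c} - q.real {c}|) ^ 2
      ≤ ∑ c, ∑ d, (p.real {c} - q.real {c}) * ((p.real {d} - q.real {d}) * gridKer c d) := by
    rw [sq, Finset.sum_mul_sum, ← Finset.sum_neg_distrib]
    refine Finset.sum_le_sum fun c _ => ?_
    rw [← Finset.sum_neg_distrib]
    refine Finset.sum_le_sum fun d _ => ?_
    rw [← mul_assoc, ← abs_mul]
    have h0 := gridKer_nonneg c d
    have h0' := gridKer_le_one c d
    have := neg_abs_le ((p.real {c} - q.real {c}) * (p.real {d} - q.real {d}))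
    have := abs_nonneg ((p.real {c} - q.real {c}) * (p.real {d} - q.real {d}))
    nlinarith
  have hexp : ∑ c, ∑ d, (p.real {c} - q.real {c}) * ((p.real {d} - q.real {d}) * gridKer c d)
      = ∑ c, ∑ d, p.real {c} * (p.real {d} * gridKer c d)
        + ∑ c, ∑ d, q.real {c} * (q.real {d} * gridKer c d)
        - 2 * ∑ c, ∑ d, p.real {c} * (q.real {d} * gridKer c d) := by
    have hsw : ∑ c, ∑ d, p.real {c} * (q.real {d} * gridKer c d)
        = ∑ c, ∑ d, q.real {c} * (p.real {d} * gridKer c d) := by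
      rw [Finset.sum_comm]
      refine Finset.sum_congr rfl fun c _ => Finset.sum_congr rfl fun d _ => ?_
      rw [gridKer_comm]; ring
    rw [two_mul]
    nth_rw 2 [hsw]
    simp only [← Finset.sum_add_distrib, ← Finset.sum_sub_distrib]
    refine Finset.sum_congr rfl fun c _ => Finset.sum_congr rfl fun d _ => ?_
    ring
  have hs0 : 0 ≤ ∑ c, |p.real {c} - q.real {c}| := Finset.sum_nonneg fun c _ => abs_nonneg _
  nlinarith

lemma abs_measureReal_Iic_sub_le (ha : Monotone a) (l m : Measure ℝ) [IsProbabilityMeasure l]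
    [IsProbabilityMeasure m] {κ r : ℝ} (hκ : ∀ i, m.real {x | a x = i} ≤ κ)
    (hr : ∀ A : Set (Fin M), |l.real {x | a x ∈ A} - m.real {x | a x ∈ A}| ≤ r)
    {x x' : ℝ} (h : a x = a x') : |l.real (Set.Iic x) - m.real (Set.Iic x')| ≤ κ + r := by
  have hr1 := abs_le.1 (hr (Set.Iic (a x)))
  have hr2 := abs_le.1 (hr (Set.Iio (a x)))
  have hk := hκ (a x)
  have hu : m.real {y | a y ∈ Set.Iic (a x)}
      ≤ m.real {y | a y ∈ Set.Iio (a x)} + m.real {y | a y = a x} := by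
    refine (measureReal_mono fun y hy => ?_).trans (measureReal_union_le _ _)
    exact lt_or_eq_of_le (show a y ≤ a x from hy)
  have b1 : l.real (Set.Iic x) ≤ l.real {y | a y ∈ Set.Iic (a x)} :=
    measureReal_mono fun y hy => ha hy
  have b2 : m.real (Set.Iic x') ≤ m.real {y | a y ∈ Set.Iic (a x)} :=
    measureReal_mono fun y hy => by
      change a y ≤ a x
      rw [h]; exact ha hy
  have b3 : l.real {y | a y ∈ Set.Iio (a x)} ≤ l.real (Set.Iic x) :=
    measureReal_mono fun y hy => (ha.reflect_lt hy).le
  have b4 : m.real {y | a y ∈ Set.Iio (a x)} ≤ m.real (Set.Iic x') :=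
    measureReal_mono fun y hy => by
      change a y < a x at hy
      rw [h] at hy; exact (ha.reflect_lt hy).le
  rw [abs_le]
  constructor <;> linarith

lemma dLPE_Omap_le (ha : Monotone a) (hb : Monotone b) (L ν : Measure Ω2)
    [IsProbabilityMeasure L] [IsProbabilityMeasure ν] {κ r : ℝ} (hκ0 : 0 ≤ κ)
    (hκa : ∀ i, ν.real {z | a z.1 = i} ≤ κ) (hκb : ∀ i, ν.real {z | b z.2 = i} ≤ κ)
    (hr : ∀ A : Set (Fin M × Fin M), |L.real {z | (a z.1, b z.2) ∈ A}
      - ν.real {z | (a z.1, b z.2) ∈ A}| ≤ r) :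
    dLPE (Omap L) (Omap ν) ≤ ENNReal.ofReal (κ + r) := by
  have hm := measurable_cell ha hb
  have hx {z z' : Ω2} (h : a z.1 = a z'.1) : |cdfX L z.1 - cdfX ν z'.1| ≤ κ + r := by
    rw [cdfX_eq, cdfX_eq]
    refine abs_measureReal_Iic_sub_le ha _ _ (fun i => ?_) (fun A => ?_) h
    · exact (map_measureReal_apply measurable_fst
        (ha.measurable (measurableSet_singleton i))).trans_le (hκa i)
    · have hA : MeasurableSet {x | a x ∈ A} := ha.measurable A.toFinite.measurableSet
      rw [map_measureReal_apply measurable_fst hA, map_measureReal_apply measurable_fst hA]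
      exact hr {c | c.1 ∈ A}
  have hy {z z' : Ω2} (h : b z.2 = b z'.2) : |cdfY L z.2 - cdfY ν z'.2| ≤ κ + r := by
    rw [cdfY_eq, cdfY_eq]
    refine abs_measureReal_Iic_sub_le hb _ _ (fun i => ?_) (fun A => ?_) h
    · exact (map_measureReal_apply measurable_snd
        (hb.measurable (measurableSet_singleton i))).trans_le (hκb i)
    · have hA : MeasurableSet {x | b x ∈ A} := hb.measurable A.toFinite.measurableSet
      rw [map_measureReal_apply measurable_snd hA, map_measureReal_apply measurable_snd hA]
      exact hr {c | c.2 ∈ A}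
  refine levyProkhorovEDist_le_of_forall_le _ _ _ fun ε B hε hε' hB => ?_
  have hlt : κ + r < ε.toReal := (ENNReal.ofReal_lt_iff_lt_toReal
    (by have := (abs_nonneg _).trans (hr ∅); linarith) hε'.ne).1 hε
  set A : Set (Fin M × Fin M) :=
    {c | ∃ z : Ω2, (a z.1, b z.2) = c ∧ (cdfX L z.1, cdfY L z.2) ∈ B} with hA
  have hmA : MeasurableSet {z : Ω2 | (a z.1, b z.2) ∈ A} := hm A.toFinite.measurableSet
  rw [Omap, Omap, Measure.map_apply measurable_cdf_prod hB,
    Measure.map_apply measurable_cdf_prod Metric.isOpen_thickening.measurableSet]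
  have s1 : L ((fun p : Ω2 => (cdfX L p.1, cdfY L p.2)) ⁻¹' B)
      ≤ L {z : Ω2 | (a z.1, b z.2) ∈ A} := measure_mono fun z hz => ⟨z, rfl, hz⟩
  have s2 : ν {z : Ω2 | (a z.1, b z.2) ∈ A}
      ≤ ν ((fun p : Ω2 => (cdfX ν p.1, cdfY ν p.2)) ⁻¹' Metric.thickening ε.toReal B) := by
    refine measure_mono fun z' hz' => ?_
    obtain ⟨z, hz, hzB⟩ := hz'
    simp only [Prod.mk.injEq] at hz
    refine Metric.mem_thickening_iff.2 ⟨_, hzB, ?_⟩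
    rw [dist_comm, Prod.dist_eq, Real.dist_eq, Real.dist_eq]
    exact (max_le (hx hz.1) (hy hz.2)).trans_lt hlt
  have s3 : L {z : Ω2 | (a z.1, b z.2) ∈ A} ≤ ν {z : Ω2 | (a z.1, b z.2) ∈ A} + ε := by
    have h1 := (abs_le.1 (hr A)).2
    rw [← ENNReal.toReal_le_toReal (measure_ne_top _ _)
      (ENNReal.add_ne_top.2 ⟨measure_ne_top _ _, hε'.ne⟩),
      ENNReal.toReal_add (measure_ne_top _ _) hε'.ne]
    rw [measureReal_def, measureReal_def] at h1
    linarith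
  calc _ ≤ _ := s1
    _ ≤ _ := s3
    _ ≤ _ := by gcongr

end Grid

/-- A probability measure without atoms on the line can be cut into finitely many intervals of
small mass. -/
lemma exists_monotone_fin_cells (m : Measure ℝ) [IsProbabilityMeasure m]
    (hm : m.map (fun x => m.real (Set.Iic x)) = unif01) {N : ℕ} (hN : N ≠ 0) :
    ∃ a : ℝ → Fin (N + 1), Monotone a ∧ ∀ i, m.real {x | a x = i} ≤ (N : ℝ)⁻¹ := by
  have hN0 : (0 : ℝ) < N := by positivity
  have hmono := monotone_measureReal_Iic (m := m)
  have hle (x : ℝ) : ⌊N * m.real (Set.Iic x)⌋₊ < N + 1 := by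
    rw [Nat.lt_succ_iff]
    refine Nat.floor_le_of_le ?_
    have : m.real (Set.Iic x) ≤ 1 := measureReal_le_one
    nlinarith
  refine ⟨fun x => ⟨⌊N * m.real (Set.Iic x)⌋₊, hle x⟩, fun x y hxy => ?_, fun i => ?_⟩
  · exact Nat.floor_le_floor (mul_le_mul_of_nonneg_left (hmono hxy) hN0.le)
  · have hsub : {x | (⟨⌊N * m.real (Set.Iic x)⌋₊, hle x⟩ : Fin (N + 1)) = i}
        ⊆ (fun x => m.real (Set.Iic x)) ⁻¹' Set.Ico ((i : ℕ) / N : ℝ) (((i : ℕ) + 1) / N) := by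
      intro x hx
      have hx' : ⌊N * m.real (Set.Iic x)⌋₊ = (i : ℕ) := congrArg Fin.val hx
      have h0 : 0 ≤ N * m.real (Set.Iic x) := mul_nonneg hN0.le measureReal_nonneg
      have h1 := Nat.floor_le h0
      have h2 := Nat.lt_floor_add_one (N * m.real (Set.Iic x))
      rw [hx'] at h1 h2
      refine ⟨?_, ?_⟩
      · rw [div_le_iff₀ hN0]; linarith
      · rw [lt_div_iff₀ hN0]; linarith
    refine (measureReal_mono hsub).trans ?_
    rw [← map_measureReal_apply hmono.measurable measurableSet_Ico, hm, unif01]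
    rw [measureReal_def]
    refine ENNReal.toReal_le_of_le_ofReal (by positivity)
      ((Measure.restrict_apply_le _ _).trans ?_)
    rw [Real.volume_Ico]
    refine ENNReal.ofReal_le_ofReal (le_of_eq ?_)
    field_simp
    ring

section Sampling

variable {μ : Measure Ω2} [IsProbabilityMeasure μ] {n : ℕ}

instance isProbabilityMeasure_pmeas : IsProbabilityMeasure (pmeas μ n) := by
  unfold pmeas; infer_instance

/-- The law of a sample from a tilted measure is the tilted law of the sample. -/
lemma pmeas_tilted {f : Ω2 → ℝ} (hf : Measurable f) {C : ℝ} (hC : ∀ z, |f z| ≤ C) (n : ℕ) :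
    pmeas (μ.tilted f) n = (pmeas μ n).tilted fun z => ∑ i, f (z i) := by
  have : IsProbabilityMeasure (μ.tilted f) :=
    isProbabilityMeasure_tilted (integrable_exp_of_abs_le hf hC)
  have key (s : Fin n → Set Ω2) (hs : ∀ i, MeasurableSet (s i)) :
      ∫ z in Set.univ.pi s, Real.exp (∑ i, f (z i)) ∂pmeas μ n
        = ∏ i, ∫ w in s i, Real.exp (f w) ∂μ := by
    rw [← integral_indicator (MeasurableSet.univ_pi hs)]
    simp only [← integral_indicator (hs _)]
    rw [pmeas, ← integral_fintype_prod_eq_prod]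
    refine integral_congr_ae (ae_of_all _ fun z => ?_)
    by_cases hz : z ∈ Set.univ.pi s
    · rw [Set.indicator_of_mem hz, Real.exp_sum]
      exact Finset.prod_congr rfl fun i _ =>
        (Set.indicator_of_mem (hz i (Set.mem_univ i)) fun w => Real.exp (f w)).symm
    · rw [Set.indicator_of_notMem hz]
      simp only [Set.mem_univ_pi, not_forall] at hz
      obtain ⟨i, hi⟩ := hz
      exact (Finset.prod_eq_zero (Finset.mem_univ i) (Set.indicator_of_notMem hi _)).symm
  have huniv := key (fun _ => Set.univ) fun _ => .univ
  simp only [Set.pi_univ, Measure.restrict_univ] at huniv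
  refine Measure.pi_eq fun s hs => ?_
  rw [tilted_apply_eq_ofReal_integral' _ (MeasurableSet.univ_pi hs), integral_div, key s hs,
    huniv, ← Finset.prod_div_distrib, ENNReal.ofReal_prod_of_nonneg]
  · refine Finset.prod_congr rfl fun i _ => ?_
    rw [tilted_apply_eq_ofReal_integral' _ (hs i), integral_div]
  · exact fun i _ => div_nonneg (integral_nonneg fun _ => (Real.exp_pos _).le)
      (integral_nonneg fun _ => (Real.exp_pos _).le)

lemma tilted_apply_le {α : Type*} [MeasurableSpace α] {P : Measure α} [SFinite P] {f : α → ℝ}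
    {S : Set α} (hS : MeasurableSet S) {B : ℝ} (hB : ∀ z ∈ S, f z ≤ B) :
    P.tilted f S ≤ ENNReal.ofReal (Real.exp B / ∫ z, Real.exp (f z) ∂P) * P S := by
  rw [tilted_apply, ← setLIntegral_const]
  refine setLIntegral_mono' hS fun z hz => ENNReal.ofReal_le_ofReal ?_
  exact div_le_div_of_nonneg_right (Real.exp_le_exp.2 (hB z hz))
    (integral_nonneg fun _ => (Real.exp_pos _).le)

lemma le_tilted_apply {α : Type*} [MeasurableSpace α] {P : Measure α} [SFinite P] {f : α → ℝ}
    {S : Set α} (hS : MeasurableSet S) {B : ℝ} (hB : ∀ z ∈ S, B ≤ f z) :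
    ENNReal.ofReal (Real.exp B / ∫ z, Real.exp (f z) ∂P) * P S ≤ P.tilted f S := by
  rw [tilted_apply, ← setLIntegral_const]
  refine setLIntegral_mono' hS fun z hz => ENNReal.ofReal_le_ofReal ?_
  exact div_le_div_of_nonneg_right (Real.exp_le_exp.2 (hB z hz))
    (integral_nonneg fun _ => (Real.exp_pos _).le)

lemma measure_le_sum_sub_le {f : Ω2 → ℝ} (hf : Measurable f) (h0 : ∀ w, 0 ≤ f w)
    (h1 : ∀ w, f w ≤ 1) (hn : n ≠ 0) {r : ℝ} (hr : 0 ≤ r) :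
    (pmeas μ n).real {z | r ≤ ∫ w, f w ∂empM z - ∫ w, f w ∂μ} ≤ Real.exp (-2 * n * r ^ 2) := by
  have hn0 : (0 : ℝ) < n := by positivity
  have hind : ProbabilityTheory.iIndepFun (fun (i : Fin n) (z : Fin n → Ω2) =>
      f (z i) - ∫ w, f w ∂μ) (pmeas μ n) :=
    ProbabilityTheory.iIndepFun_pi (μ := fun _ : Fin n => μ)
      (X := fun _ w => f w - ∫ w, f w ∂μ) (fun _ => (hf.sub_const _).aemeasurable)
  have hsub (i : Fin n) : ProbabilityTheory.HasSubgaussianMGF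
      (fun z : Fin n → Ω2 => f (z i) - ∫ w, f w ∂μ) ((‖(1 : ℝ) - 0‖₊ / 2) ^ 2) (pmeas μ n) := by
    have := ProbabilityTheory.hasSubgaussianMGF_of_mem_Icc (μ := pmeas μ n) (a := 0) (b := 1)
      (X := fun z => f (z i)) (hf.comp (measurable_pi_apply i)).aemeasurable
      (ae_of_all _ fun z => ⟨h0 _, h1 _⟩)
    have e : ∫ z, f (z i) ∂pmeas μ n = ∫ w, f w ∂μ := by
      have hp := measurePreserving_eval (fun _ : Fin n => μ) i
      conv_rhs => rw [← hp.map_eq, integral_map hp.aemeasurable hf.aestronglyMeasurable]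
      rfl
    rwa [e] at this
  have := ProbabilityTheory.HasSubgaussianMGF.measure_sum_ge_le_of_iIndepFun hind
    (s := Finset.univ) (fun i _ => hsub i) (ε := n * r) (by positivity)
  have hset : {z : Fin n → Ω2 | r ≤ ∫ w, f w ∂empM z - ∫ w, f w ∂μ}
      = {z | n * r ≤ ∑ i, (f (z i) - ∫ w, f w ∂μ)} := by
    ext z
    simp only [Set.mem_ofPred_eq, integral_empM, Finset.sum_sub_distrib, Finset.sum_const,
      Finset.card_univ, Fintype.card_fin, nsmul_eq_mul]
    rw [le_sub_iff_add_le, le_div_iff₀ hn0, le_sub_iff_add_le]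
    ring_nf
  rw [hset]
  refine this.trans_eq ?_
  congr 1
  simp
  field_simp

/-- Hoeffding's inequality for empirical measures. -/
lemma measure_le_abs_sub_le {f : Ω2 → ℝ} (hf : Measurable f) (h0 : ∀ w, 0 ≤ f w)
    (h1 : ∀ w, f w ≤ 1) (hn : n ≠ 0) {r : ℝ} (hr : 0 ≤ r) :
    pmeas μ n {z | r ≤ |∫ w, f w ∂empM z - ∫ w, f w ∂μ|}
      ≤ ENNReal.ofReal (2 * Real.exp (-2 * n * r ^ 2)) := by
  have e1 := measure_le_sum_sub_le (μ := μ) hf h0 h1 hn hr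
  have e2 := measure_le_sum_sub_le (μ := μ) (f := fun w => 1 - f w) (measurable_const.sub hf)
    (fun w => sub_nonneg.2 (h1 w)) (fun w => sub_le_self _ (h0 w)) hn hr
  have hi (ρ : Measure Ω2) [IsProbabilityMeasure ρ] : Integrable f ρ :=
    Integrable.of_mem_Icc 0 1 hf.aemeasurable (ae_of_all _ fun w => ⟨h0 w, h1 w⟩)
  have hsub : {z : Fin n → Ω2 | r ≤ |∫ w, f w ∂empM z - ∫ w, f w ∂μ|}
      ⊆ {z | r ≤ ∫ w, f w ∂empM z - ∫ w, f w ∂μ}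
        ∪ {z | r ≤ ∫ w, (1 - f w) ∂empM z - ∫ w, (1 - f w) ∂μ} := by
    intro z hz
    have := isProbabilityMeasure_empM hn z
    refine (le_abs.1 (show r ≤ |_| from hz)).imp id fun h => ?_
    change r ≤ _
    rw [integral_sub (integrable_const _) (hi _), integral_sub (integrable_const _) (hi _)]
    simp only [integral_const, probReal_univ, smul_eq_mul, mul_one]
    linarith
  rw [ENNReal.le_ofReal_iff_toReal_le (measure_ne_top _ _) (by positivity), ← measureReal_def]
  have := (measureReal_mono (μ := pmeas μ n) hsub).trans (measureReal_union_le _ _)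
  linarith

lemma tPat_empM (hn : n ≠ 0) (z : Fin n → Ω2) :
    tPat inv2 (empM z) = (∑ i, (∑ j, invKer (z i) (z j)) / n) / n := by
  have := isProbabilityMeasure_empM hn z
  rw [tPat_inv2, integral_empM]
  simp only [invPot, integral_empM]

lemma measurable_invKer_pair (i j : Fin n) :
    Measurable fun z : Fin n → Ω2 => invKer (z i) (z j) := by
  have h : Measurable fun z : Fin n → Ω2 => (z i, z j) :=
    (measurable_pi_apply i).prodMk (measurable_pi_apply j)
  exact measurable_invKer.comp h

lemma measurable_tPat_empM (hn : n ≠ 0) :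
    Measurable fun z : Fin n → Ω2 => tPat inv2 (empM z) := by
  simp only [tPat_empM hn]
  exact (Finset.measurable_sum _ fun i _ => (Finset.measurable_sum _ fun j _ =>
    measurable_invKer_pair i j).div_const _).div_const _

lemma integral_tPat_empM (hn : n ≠ 0) :
    ∫ z, tPat inv2 (empM z) ∂pmeas μ n = (1 - (n : ℝ)⁻¹) * tPat inv2 μ := by
  have hn0 : (n : ℝ) ≠ 0 := by positivity
  have hi (i j : Fin n) : Integrable (fun z : Fin n → Ω2 => invKer (z i) (z j)) (pmeas μ n) :=
    .of_bound (measurable_invKer_pair i j).aestronglyMeasurable 1 (ae_of_all _ fun z => by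
      rw [Real.norm_of_nonneg (invKer_nonneg _ _)]; exact invKer_le_one _ _)
  have hij (i j : Fin n) : ∫ z, invKer (z i) (z j) ∂pmeas μ n
      = tPat inv2 μ - if i = j then tPat inv2 μ else 0 := by
    split_ifs with h
    · simp [h, invKer_self]
    · rw [sub_zero, tPat_inv2]
      unfold invPot
      have hp := measurePreserving_pair (μ := μ) h
      rw [integral_integral (integrable_invKer (μ.prod μ)), ← hp.map_eq,
        integral_map hp.aemeasurable measurable_invKer.aestronglyMeasurable]
  simp only [tPat_empM hn]
  rw [integral_div, integral_finsetSum _ fun i _ =>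
    (integrable_finsetSum _ fun j _ => hi i j).div_const _]
  simp only [integral_div, integral_finsetSum _ fun j _ => hi _ j, hij, Finset.sum_sub_distrib]
  simp
  field_simp

/-- If `μ` has inversion density `1 / 2`, a sample of size `n` has inversion density at most `1 / 2`
with probability at least `1 / n`. -/
lemma inv_le_measure_tPat_le (hn : n ≠ 0) (hμ : tPat inv2 μ = 1 / 2) :
    (n : ℝ)⁻¹ ≤ (pmeas μ n).real {z | tPat inv2 (empM z) ≤ 1 / 2} := by
  have hm := measurable_tPat_empM hn
  have hS : MeasurableSet {z : Fin n → Ω2 | tPat inv2 (empM z) ≤ 1 / 2} :=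
    measurableSet_le hm measurable_const
  have h01 (z : Fin n → Ω2) : 0 ≤ tPat inv2 (empM z) ∧ tPat inv2 (empM z) ≤ 1 := by
    have := isProbabilityMeasure_empM hn z
    rw [tPat_inv2]
    refine ⟨integral_nonneg fun w => invPot_nonneg _ _, ?_⟩
    simpa using integral_mono (integrable_invPot (empM z) (empM z)) (integrable_const (1 : ℝ))
      (invPot_le_one _)
  have hi : Integrable (fun z : Fin n → Ω2 => tPat inv2 (empM z)) (pmeas μ n) :=
    Integrable.of_mem_Icc 0 1 hm.aemeasurable (ae_of_all _ h01)
  have h1 := integral_mono (μ := pmeas μ n) ((integrable_const (1 / 2)).sub hi)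
    (((integrable_const (1 : ℝ)).indicator hS).const_mul (1 / 2)) fun z => by
      by_cases hz : tPat inv2 (empM z) ≤ 1 / 2
      · have := (h01 z).1
        simp only [Pi.sub_apply, Set.indicator_apply, Set.mem_ofPred_eq, if_pos hz]; linarith
      · simp only [Pi.sub_apply, Set.indicator_apply, Set.mem_ofPred_eq, if_neg hz]; linarith
  simp only [Pi.sub_apply] at h1
  rw [integral_sub (integrable_const _) hi, integral_tPat_empM hn, hμ, integral_const_mul] at h1
  have e := integral_indicator_one (μ := pmeas μ n) hS
  simp only [Pi.one_def] at e
  rw [e] at h1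
  simp at h1
  linarith

end Sampling

section Conditioning

lemma measurable_integral_empM {n : ℕ} {f : Ω2 → ℝ} (hf : Measurable f) :
    Measurable fun z : Fin n → Ω2 => ∫ w, f w ∂empM z := by
  simp only [integral_empM]
  exact (Finset.measurable_sum _ fun i _ => hf.comp (measurable_pi_apply i)).div_const _

lemma sum_two_mul_invPot_eq (ν : Measure Ω2) (η : ℝ) {n : ℕ} (hn : n ≠ 0) (z : Fin n → Ω2) :
    ∑ i, 2 * η * invPot ν (z i) = n * η * (2 * ∫ w, invPot ν w ∂empM z) := by
  have hn0 : (n : ℝ) ≠ 0 := by positivity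
  rw [← Finset.mul_sum, integral_empM]
  field_simp

variable {ν' : Measure Ω2} [IsProbabilityMeasure ν'] {η : ℝ}

lemma abs_two_mul_invPot_le (hη : 0 < η) (z : Ω2) : |2 * η * invPot ν' z| ≤ 2 * η := by
  have := invPot_nonneg ν' z
  have := invPot_le_one ν' z
  rw [abs_of_nonneg (by positivity)]
  nlinarith

/-- Lower bound for the probability that a sample has inversion density at most `1 / 2`. -/
lemma le_pmeas_tPat_le (hη : 0 < η) (ht : tPat inv2 ν' = 1 / 2) {n : ℕ} (hn : n ≠ 0) {δ : ℝ}
    (hδ : 0 ≤ δ) :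
    ENNReal.ofReal (Real.exp (n * η * (1 - 2 * δ))
        / ∫ z, Real.exp (∑ i, 2 * η * invPot ν' (z i)) ∂pmeas ν' n)
      * ENNReal.ofReal ((n : ℝ)⁻¹ - 2 * Real.exp (-2 * n * δ ^ 2))
    ≤ pmeas (ν'.tilted fun z => 2 * η * invPot ν' z) n {z | tPat inv2 (empM z) ≤ 1 / 2} := by
  have hVm := measurable_invPot ν'
  rw [pmeas_tilted (hVm.const_mul _) (abs_two_mul_invPot_le hη)]
  set T : Set (Fin n → Ω2) := {z | tPat inv2 (empM z) ≤ 1 / 2} with hT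
  set U : Set (Fin n → Ω2) :=
    {z | δ ≤ |∫ w, invPot ν' w ∂empM z - ∫ w, invPot ν' w ∂ν'|} with hU
  have hTm : MeasurableSet T := measurableSet_le (measurable_tPat_empM hn) measurable_const
  have hUm : MeasurableSet U :=
    measurableSet_le measurable_const ((measurable_integral_empM hVm).sub_const _).abs
  have hUle : pmeas ν' n U ≤ _ :=
    measure_le_abs_sub_le hVm (invPot_nonneg ν') (invPot_le_one ν') hn hδ
  have h1 : ENNReal.ofReal ((n : ℝ)⁻¹ - 2 * Real.exp (-2 * n * δ ^ 2)) ≤ pmeas ν' n (T \ U) := by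
    refine le_trans ?_ (le_measure_sdiff (μ := pmeas ν' n) (s₁ := T) (s₂ := U))
    rw [ENNReal.ofReal_sub _ (by positivity)]
    refine tsub_le_tsub ?_ hUle
    rw [ENNReal.ofReal_le_iff_le_toReal (measure_ne_top _ _)]
    exact inv_le_measure_tPat_le hn ht
  refine (mul_le_mul_right h1 _).trans ?_
  refine (le_tilted_apply (hTm.diff hUm) fun z hz => ?_).trans (measure_mono Set.sdiff_subset)
  have h2 : |∫ w, invPot ν' w ∂empM z - ∫ w, invPot ν' w ∂ν'| < δ := not_le.1 hz.2
  rw [← tPat_inv2, ht] at h2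
  rw [sum_two_mul_invPot_eq ν' η hn]
  have := (abs_lt.1 h2).1
  have hn0 : (0 : ℝ) < n := by positivity
  refine mul_le_mul_of_nonneg_left ?_ (by positivity)
  linarith

/-- Upper bound for the probability that a sample has inversion density at most `1 / 2` while its
rescaling is far from that of `ν'`. -/
lemma pmeas_far_le (hη : 0 < η) (hη' : η ≤ 1 / 16) (ht : tPat inv2 ν' = 1 / 2) {M : ℕ}
    {a b : ℝ → Fin M} (ha : Monotone a) (hb : Monotone b) {κ δ ε : ℝ} (hκ0 : 0 ≤ κ) (hδ : 0 < δ)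
    (hκδ : κ + δ < ε) (hκa : ∀ i, ν'.real {z | a z.1 = i} ≤ κ)
    (hκb : ∀ i, ν'.real {z | b z.2 = i} ≤ κ) {n : ℕ} (hn : n ≠ 0) :
    pmeas (ν'.tilted fun z => 2 * η * invPot ν' z) n
      {z | ENNReal.ofReal ε ≤ dLPE (Omap (empM z)) (Omap ν') ∧ tPat inv2 (empM z) ≤ 1 / 2}
    ≤ ENNReal.ofReal (Nat.card (Set (Fin M × Fin M)) * ((n + 1) *
        (Real.exp (n * η * (1 + 4 * κ)) / (∫ z, Real.exp (∑ i, 2 * η * invPot ν' (z i)) ∂pmeas ν' n)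
          * (2 * Real.exp (-n * δ ^ 2))))) := by
  classical
  have hVm := measurable_invPot ν'
  have hm := measurable_cell ha hb
  have hn0 : (0 : ℝ) < n := by positivity
  rw [pmeas_tilted (hVm.const_mul _) (abs_two_mul_invPot_le hη)]
  set Z := ∫ z, Real.exp (∑ i, 2 * η * invPot ν' (z i)) ∂pmeas ν' n with hZ
  have hZ0 : 0 ≤ Z := integral_nonneg fun _ => (Real.exp_pos _).le
  set c : Ω2 → Fin M × Fin M := fun z => (a z.1, b z.2) with hc
  have hcm (A : Set (Fin M × Fin M)) : MeasurableSet (c ⁻¹' A) := hm A.toFinite.measurableSet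
  set s : Set (Fin M × Fin M) → ℕ → ℝ := fun A k => |(k : ℝ) / n - ν'.real (c ⁻¹' A)| with hs
  set S : Set (Fin M × Fin M) → ℕ → Set (Fin n → Ω2) := fun A k =>
    {z | δ < s A k} ∩ {z | 2 * ∫ w, invPot ν' w ∂empM z ≤ 1 + 4 * s A k ^ 2 + 4 * κ} ∩
      {z | s A k ≤ |∫ w, (c ⁻¹' A).indicator 1 w ∂empM z - ∫ w, (c ⁻¹' A).indicator 1 w ∂ν'|}
    with hS
  have hind (A : Set (Fin M × Fin M)) : Measurable ((c ⁻¹' A).indicator (1 : Ω2 → ℝ)) :=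
    measurable_const.indicator (hcm A)
  have hSm (A k) : MeasurableSet (S A k) :=
    ((MeasurableSet.const _).inter
      (measurableSet_le ((measurable_integral_empM hVm).const_mul _) measurable_const)).inter
      (measurableSet_le measurable_const ((measurable_integral_empM (hind A)).sub_const _).abs)
  have hcover : {z : Fin n → Ω2 | ENNReal.ofReal ε ≤ dLPE (Omap (empM z)) (Omap ν')
      ∧ tPat inv2 (empM z) ≤ 1 / 2} ⊆ ⋃ A, ⋃ k ∈ Finset.range (n + 1), S A k := by
    rintro z ⟨hz1, hz2⟩
    have := isProbabilityMeasure_empM hn z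
    obtain ⟨A, hA⟩ := Finite.exists_max fun A : Set (Fin M × Fin M) =>
      |(empM z).real (c ⁻¹' A) - ν'.real (c ⁻¹' A)|
    have hδA : δ < |(empM z).real (c ⁻¹' A) - ν'.real (c ⁻¹' A)| := by
      by_contra hle
      have := hz1.trans (dLPE_Omap_le ha hb (empM z) ν' hκ0 hκa hκb
        fun B => (hA B).trans (not_lt.1 hle))
      rw [ENNReal.ofReal_le_ofReal_iff (by positivity)] at this
      linarith
    have h2 := two_mul_integral_invPot_le ha hb (empM z) ν' hκa hκb hA
    set k := (Finset.univ.filter fun i => z i ∈ c ⁻¹' A).card with hk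
    have hkn : k < n + 1 := Nat.lt_succ_of_le ((Finset.card_le_univ _).trans_eq (by simp))
    have hkr : (empM z).real (c ⁻¹' A) = k / n := by
      rw [measureReal_empM z (hcm A), hk]
      simp [Set.indicator_apply]
    have hsk : s A k = |(empM z).real (c ⁻¹' A) - ν'.real (c ⁻¹' A)| := by rw [hkr]
    refine Set.mem_iUnion.2 ⟨A, Set.mem_iUnion₂.2 ⟨k, Finset.mem_range.2 hkn, ⟨?_, ?_⟩, ?_⟩⟩
    · change δ < s A k
      rwa [hsk]
    · change _ ≤ 1 + 4 * s A k ^ 2 + 4 * κ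
      rw [hsk]
      linarith
    · change s A k ≤ _
      rw [integral_indicator_one (hcm A), integral_indicator_one (hcm A), hsk]
  have hbound (A k) : (pmeas ν' n).tilted (fun z => ∑ i, 2 * η * invPot ν' (z i)) (S A k)
      ≤ ENNReal.ofReal (Real.exp (n * η * (1 + 4 * κ)) / Z * (2 * Real.exp (-n * δ ^ 2))) := by
    by_cases hsδ : δ < s A k
    · have hle : ∀ z ∈ S A k, ∑ i, 2 * η * invPot ν' (z i)
          ≤ n * η * (1 + 4 * s A k ^ 2 + 4 * κ) := fun z hz => by
        rw [sum_two_mul_invPot_eq ν' η hn]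
        exact mul_le_mul_of_nonneg_left hz.1.2 (by positivity)
      have hH := measure_le_abs_sub_le (μ := ν') (hind A)
        (Set.indicator_nonneg fun _ _ => zero_le_one)
        (Set.indicator_le_self' (fun _ _ => zero_le_one)) hn (hδ.trans hsδ).le
      refine (tilted_apply_le (hSm A k) hle).trans ((mul_le_mul_right
        ((measure_mono Set.inter_subset_right).trans hH) _).trans ?_)
      rw [← ENNReal.ofReal_mul (by positivity)]
      refine ENNReal.ofReal_le_ofReal ?_
      rw [div_mul_eq_mul_div, div_mul_eq_mul_div]
      refine div_le_div_of_nonneg_right ?_ hZ0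
      rw [mul_left_comm, mul_left_comm (Real.exp _), ← Real.exp_add, ← Real.exp_add]
      refine mul_le_mul_of_nonneg_left (Real.exp_le_exp.2 ?_) zero_le_two
      have hsq : δ ^ 2 ≤ s A k ^ 2 := pow_le_pow_left₀ hδ.le hsδ.le 2
      have h3 : (n : ℝ) * δ ^ 2 ≤ n * s A k ^ 2 := mul_le_mul_of_nonneg_left hsq hn0.le
      have h4 : η * (n * s A k ^ 2) ≤ 1 / 16 * (n * s A k ^ 2) :=
        mul_le_mul_of_nonneg_right hη' (by positivity)
      nlinarith
    · have : S A k = ∅ := by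
        ext z
        simp only [Set.mem_empty_iff_false, iff_false]
        exact fun hz => hsδ hz.1.1
      rw [this, measure_empty]
      exact zero_le
  refine (measure_mono hcover).trans ((measure_iUnion_fintype_le _ _).trans ?_)
  refine (Finset.sum_le_sum fun A _ => (measure_biUnion_finset_le _ _).trans
    (Finset.sum_le_sum fun k _ => hbound A k)).trans_eq ?_
  generalize Real.exp (n * η * (1 + 4 * κ)) / Z * (2 * Real.exp (-n * δ ^ 2)) = W
  rw [Finset.sum_const, Finset.sum_const, Finset.card_range, Finset.card_univ,
    ← Nat.card_eq_fintype_card, nsmul_eq_mul, nsmul_eq_mul, ENNReal.ofReal_mul (Nat.cast_nonneg _),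
    ENNReal.ofReal_mul (by positivity), ENNReal.ofReal_natCast, ← Nat.cast_add_one,
    ENNReal.ofReal_natCast]

/-- Under `ν'` tilted by its inversion potential, conditioning a sample on having inversion density
at most `1 / 2` forces its rescaling to approach that of `ν'`. -/
lemma tendsto_pmeas_tilted_div (hac : ν' ≪ lebSq) (hca : lebSq ≪ ν') (hη : 0 < η)
    (hη' : η ≤ 1 / 16) (ht : tPat inv2 ν' = 1 / 2) {ε : ℝ} (hε : 0 < ε) :
    Tendsto (fun n : ℕ => pmeas (ν'.tilted fun z => 2 * η * invPot ν' z) n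
        {z | ENNReal.ofReal ε ≤ dLPE (Omap (empM z)) (Omap ν') ∧ tPat inv2 (empM z) ≤ 1 / 2}
      / pmeas (ν'.tilted fun z => 2 * η * invPot ν' z) n {z | tPat inv2 (empM z) ≤ 1 / 2})
      atTop (𝓝 0) := by
  set δ := ε / 3 with hδ
  have hδ0 : 0 < δ := by positivity
  obtain ⟨N, hN⟩ := exists_nat_gt (min δ (δ ^ 2))⁻¹
  have hmin : 0 < min δ (δ ^ 2) := lt_min hδ0 (by positivity)
  have hN0 : (0 : ℝ) < N := (inv_pos.2 hmin).trans hN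
  have hNne : N ≠ 0 := by rintro rfl; simp at hN0
  have hκ : (N : ℝ)⁻¹ < min δ (δ ^ 2) := inv_lt_of_inv_lt₀ hmin hN
  obtain ⟨a, ha, hκa⟩ := exists_monotone_fin_cells _
    (map_measureReal_Iic (map_fst_ac hac) (ac_map_fst hca)) hNne
  obtain ⟨b, hb, hκb⟩ := exists_monotone_fin_cells _
    (map_measureReal_Iic (map_snd_ac hac) (ac_map_snd hca)) hNne
  have hκa' (i) : ν'.real {z | a z.1 = i} ≤ (N : ℝ)⁻¹ := by
    have h := hκa i
    rwa [map_measureReal_apply measurable_fst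
      (show MeasurableSet {x | a x = i} from ha.measurable (measurableSet_singleton i))] at h
  have hκb' (i) : ν'.real {z | b z.2 = i} ≤ (N : ℝ)⁻¹ := by
    have h := hκb i
    rwa [map_measureReal_apply measurable_snd
      (show MeasurableSet {x | b x = i} from hb.measurable (measurableSet_singleton i))] at h
  set K : ℝ := ((Nat.card (Set (Fin (N + 1) × Fin (N + 1))) : ℕ) : ℝ) with hK
  set q := Real.exp (-(δ ^ 2 / 2)) with hq
  have hq1 : q < 1 := Real.exp_lt_one_iff.mpr (by rw [neg_lt_zero]; positivity)
  set q' := Real.exp (-2 * (δ ^ 2) ^ 2) with hq'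
  have hq1' : q' < 1 := Real.exp_lt_one_iff.mpr (by
    have : 0 < (δ ^ 2) ^ 2 := by positivity
    linarith)
  have hlim :
      Tendsto (fun n : ℕ => ENNReal.ofReal (8 * K * ((n : ℝ) ^ 2 * q ^ n))) atTop (𝓝 0) := by
    have := (tendsto_pow_const_mul_const_pow_of_abs_lt_one 2
      (by rwa [abs_of_pos (Real.exp_pos _)] : |q| < 1)).const_mul (8 * K)
    simpa using ENNReal.tendsto_ofReal this
  have hev : ∀ᶠ n : ℕ in atTop, (n : ℝ) * q' ^ n < 1 / 4 := by
    have := tendsto_pow_const_mul_const_pow_of_abs_lt_one 1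
      (by rwa [abs_of_pos (Real.exp_pos _)] : |q'| < 1)
    simp only [pow_one] at this
    exact this.eventually_lt_const (by norm_num)
  refine tendsto_of_tendsto_of_tendsto_of_le_of_le' tendsto_const_nhds hlim
    (Eventually.of_forall fun n => zero_le) ?_
  filter_upwards [hev, eventually_ge_atTop 1] with n hn4 hn1
  have hn : n ≠ 0 := by omega
  have hnr : (1 : ℝ) ≤ n := by exact_mod_cast hn1
  have hup := pmeas_far_le hη hη' ht ha hb (inv_nonneg.2 hN0.le) hδ0
    (by have := hκ.trans_le (min_le_left _ _); linarith : (N : ℝ)⁻¹ + δ < ε) hκa' hκb' hn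
  have hlow := le_pmeas_tPat_le hη ht hn (sq_nonneg δ)
  set Z := ∫ z, Real.exp (∑ i, 2 * η * invPot ν' (z i)) ∂pmeas ν' n with hZ
  have hZ0 : 0 < Z := by
    refine integral_exp_pos (integrable_exp_of_abs_le (C := ∑ _i : Fin n, 2 * η) ?_ fun z => ?_)
    · exact Finset.measurable_sum _ fun i _ =>
        ((measurable_invPot ν').comp (measurable_pi_apply i)).const_mul _
    · exact (Finset.abs_sum_le_sum_abs _ _).trans
        (Finset.sum_le_sum fun i _ => abs_two_mul_invPot_le hη _)
  have hp' : Real.exp (-2 * n * (δ ^ 2) ^ 2) = q' ^ n := by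
    rw [hq', ← Real.exp_nat_mul]; ring_nf
  have hnn : (n : ℝ) * (n : ℝ)⁻¹ = 1 := mul_inv_cancel₀ (by positivity)
  have hsub : (n : ℝ)⁻¹ / 2 ≤ (n : ℝ)⁻¹ - 2 * Real.exp (-2 * n * (δ ^ 2) ^ 2) := by
    rw [hp']
    have : q' ^ n ≤ (n : ℝ)⁻¹ / 4 := by
      rw [← mul_le_mul_iff_right₀ (by positivity : (0 : ℝ) < n)]
      linarith
    linarith
  rw [← ENNReal.ofReal_mul (by positivity)] at hlow
  have hlow' : 0 < Real.exp (n * η * (1 - 2 * δ ^ 2)) / Z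
      * ((n : ℝ)⁻¹ - 2 * Real.exp (-2 * n * (δ ^ 2) ^ 2)) :=
    mul_pos (by positivity) (lt_of_lt_of_le (by positivity) hsub)
  refine (ENNReal.div_le_div hup hlow).trans ?_
  rw [← ENNReal.ofReal_div_of_pos hlow']
  refine ENNReal.ofReal_le_ofReal ?_
  rw [div_le_iff₀ hlow']
  have hexp : Real.exp (n * η * (1 + 4 * (N : ℝ)⁻¹)) * Real.exp (-n * δ ^ 2)
      ≤ q ^ n * Real.exp (n * η * (1 - 2 * δ ^ 2)) := by
    rw [hq, ← Real.exp_nat_mul, ← Real.exp_add, ← Real.exp_add, Real.exp_le_exp]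
    have h1 : (N : ℝ)⁻¹ ≤ δ ^ 2 := (hκ.trans_le (min_le_right _ _)).le
    have h2 : η * (4 * (N : ℝ)⁻¹ + 2 * δ ^ 2) ≤ 1 / 16 * (6 * δ ^ 2) :=
      mul_le_mul hη' (by linarith) (by positivity) (by norm_num)
    have h3 : (n : ℝ) * (η * (4 * (N : ℝ)⁻¹ + 2 * δ ^ 2)) ≤ n * (1 / 2 * δ ^ 2) :=
      mul_le_mul_of_nonneg_left (h2.trans (by nlinarith [sq_nonneg δ])) (by positivity)
    nlinarith
  set E := Real.exp (n * η * (1 - 2 * δ ^ 2)) with hE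
  have hE0 : 0 < E := Real.exp_pos _
  have hK0 : 0 ≤ K := Nat.cast_nonneg _
  have hqn : 0 < q ^ n := pow_pos (Real.exp_pos _) n
  calc K * ((n + 1) * (Real.exp (n * η * (1 + 4 * (N : ℝ)⁻¹)) / Z * (2 * Real.exp (-n * δ ^ 2))))
      = K * ((n + 1) * (2 * ((Real.exp (n * η * (1 + 4 * (N : ℝ)⁻¹)) * Real.exp (-n * δ ^ 2)) / Z)))
        := by ring
    _ ≤ K * ((n + n) * (2 * ((q ^ n * E) / Z))) := by gcongr
    _ = 8 * K * (n ^ 2 * q ^ n) * (E / Z * ((n : ℝ)⁻¹ / 2)) := by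
        field_simp
        ring
    _ ≤ _ := by gcongr

lemma tendsto_pmeas_inducedPerm_div (hac : ν' ≪ lebSq) (hca : lebSq ≪ ν') (hη : 0 < η)
    (hη' : η ≤ 1 / 16) (ht : tPat inv2 ν' = 1 / 2) {ε : ℝ} (hε : 0 < ε) :
    Tendsto (fun n : ℕ => pmeas (ν'.tilted fun z => 2 * η * invPot ν' z) n
        {z | ENNReal.ofReal ε ≤ dLPE (EmM (inducedPerm z)) (Omap ν') ∧
          tPerm inv2 (inducedPerm z) ≤ 1 / 2}
      / pmeas (ν'.tilted fun z => 2 * η * invPot ν' z) n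
        {z | tPerm inv2 (inducedPerm z) ≤ 1 / 2})
      atTop (𝓝 0) := by
  refine (tendsto_pmeas_tilted_div hac hca hη hη' ht hε).congr' ?_
  filter_upwards [eventually_ge_atTop 1] with n hn1
  have hn : n ≠ 0 := by omega
  have : IsProbabilityMeasure (ν'.tilted fun z => 2 * η * invPot ν' z) :=
    isProbabilityMeasure_tilted
      (integrable_exp_of_abs_le ((measurable_invPot ν').const_mul _) (abs_two_mul_invPot_le hη))
  have hac' : (ν'.tilted fun z => 2 * η * invPot ν' z) ≪ lebSq :=
    (tilted_absolutelyContinuous _ _).trans hac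
  have hx := ae_injective_of_forall_eq_null measurable_fst (fun x => hac' (lebSq_fst_eq x)) n
  have hy := ae_injective_of_forall_eq_null measurable_snd (fun y => hac' (lebSq_snd_eq y)) n
  congr 1
  · refine measure_congr ?_
    filter_upwards [hx, hy] with z h1 h2
    refine propext ?_
    change (_ ∧ _) ↔ (_ ∧ _)
    rw [EmM_inducedPerm hn h1 h2, tPerm_inducedPerm hn h1 h2]
  · refine measure_congr ?_
    filter_upwards [hx, hy] with z h1 h2
    refine propext ?_
    change _ ≤ _ ↔ _ ≤ _
    rw [tPerm_inducedPerm hn h1 h2]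

end Conditioning

/-- Theorem 1.18 (ii): there is `θ_c > 0` such that for each
`θ ∈ (0,θ_c)` the problem `sup_{ν∈ℳ}{θ t_{21}(ν) − D(ν|λ)}` has a unique maximizer `ν_θ`,
and there is a permuton `ν* ≠ λ` such that the `ν_θ`-random permutations, conditioned on
`{t_{21}(π_{n,ν_θ}) ≤ 1/2}`, converge in probability to `ν*`. -/
theorem conditioning_and_limits_do_not_commute :
    ∃ θc > (0 : ℝ), ∀ θ ∈ Set.Ioo (0 : ℝ) θc,
      ∃ νθ : ProbabilityMeasure Ω2, Fset inv2 lebSq θ = {νθ} ∧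
        ∃ νstar : ProbabilityMeasure Ω2, νstar ∈ Mtilde ∧ (νstar : Measure Ω2) ≠ lebSq ∧
          ∀ ε > (0 : ℝ),
            Tendsto (fun n : ℕ =>
                pmeas (↑νθ) n {z | ENNReal.ofReal ε ≤
                    dLPE (EmM (inducedPerm z)) (↑νstar) ∧
                    tPerm inv2 (inducedPerm z) ≤ 1 / 2} /
                  pmeas (↑νθ) n {z | tPerm inv2 (inducedPerm z) ≤ 1 / 2})
              atTop (𝓝 0) := by
  obtain ⟨θc, hθc, H⟩ := exists_balanced_tilt
  refine ⟨θc, hθc, fun θ hθ => ?_⟩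
  obtain ⟨νθ, ν', η, _, _, hθ16, hη, hη', hself, hself', ht, ht'⟩ := H θ hθ
  have hac : ν' ≪ lebSq := hself'.ac
  have hca : lebSq ≪ ν' := hself'.lebSq_ac
  refine ⟨⟨νθ, inferInstance⟩,
    IsSelfTilt.Fset_eq hself (by rwa [abs_of_pos hθ.1]),
    ⟨Omap ν', isProbabilityMeasure_Omap⟩,
    ⟨Omap_unitSq, Omap_map_fst hac hca, Omap_map_snd hac hca⟩,
    hself'.Omap_ne_lebSq hself.ac hθ.1 ht ht', fun ε hε => ?_⟩
  have e := hself.eq_tilted_invPot hself'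
  simp only [ProbabilityMeasure.coe_mk]
  rw [e]
  exact tendsto_pmeas_inducedPerm_div hac hca hη hη' ht' hε

end
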